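/- Let T1', T2' be two incompatible unrooted binary phylogenetic trees obtained after a single application of the common 2-chain reduction (2-cc) on trees T1 and T2 applied to a common chain C such that the corresponding grid g(C) is NOT a separator of the display graph D(T1,T2). Then d_tw(T1',T2') ≤ d_tw(T1,T2) ≤ d_tw(T1',T2') + 1. -/

import Mathlib

open SimpleGraph

/-- `G` has a tree decomposition of width at most `k`: a tree `t` together with
bags satisfying (tw1), (tw2) and (tw3), all of whose bags have size at most `k+1`. -/
def HasTreeDecompWidthLE {V : Type*} (G : SimpleGraph V) (k : ℕ) : Prop :=
  ∃ (n : ℕ) (t : SimpleGraph (Fin (n + 1))) (bag : Fin (n + 1) → Finset V),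
    t.IsTree ∧
    (∀ v : V, ∃ i, v ∈ bag i) ∧
    (∀ u v : V, G.Adj u v → ∃ i, u ∈ bag i ∧ v ∈ bag i) ∧
    (∀ v : V, (t.induce {i | v ∈ bag i}).Connected) ∧
    (∀ i, (bag i).card ≤ k + 1)

/-- The treewidth of a graph: the least `k` such that `G` has a tree decomposition
of width `k`. -/
noncomputable def treewidth {V : Type*} (G : SimpleGraph V) : ℕ :=
  sInf {k | HasTreeDecompWidthLE G k}

/-- An unrooted binary phylogenetic graph (tree or network) on label set `X`:
a finite connected graph whose degree-1 vertices are bijectively labelled by `X`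
and all of whose other vertices have degree 3. -/
structure PhyloGraph (V : Type*) (X : Type*) where
  graph : SimpleGraph V
  finite : Finite V
  connected : graph.Connected
  leaf : X → V
  leaf_inj : Function.Injective leaf
  leaf_deg : ∀ x : X, (graph.neighborSet (leaf x)).ncard = 1
  internal_deg : ∀ v : V, (∀ x : X, leaf x ≠ v) → (graph.neighborSet v).ncard = 3

/-- An unrooted binary phylogenetic tree on label set `X`. -/
structure PhyloTree (V : Type*) (X : Type*) extends PhyloGraph V X where
  acyclic : graph.IsAcyclic

open Classical in
/-- The map identifying a leaf of the second graph with the leaf of the first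
graph carrying the same label. -/
noncomputable def mergeMap {V1 V2 X : Type*} (l1 : X → V1) (l2 : X → V2) :
    V1 ⊕ V2 → V1 ⊕ V2
  | Sum.inl v => Sum.inl v
  | Sum.inr w => if h : ∃ x, l2 x = w then Sum.inl (l1 h.choose) else Sum.inr w

lemma mergeMap_idem {V1 V2 X : Type*} (l1 : X → V1) (l2 : X → V2) (u : V1 ⊕ V2) :
    mergeMap l1 l2 (mergeMap l1 l2 u) = mergeMap l1 l2 u := by
  classical
  cases u with
  | inl v => rfl
  | inr w =>
    by_cases h : ∃ x, l2 x = w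
    · simp [mergeMap, h]
    · simp [mergeMap, h]

/-- The vertex set of the display graph: the disjoint union of the vertex sets
of the two graphs, with leaves carrying the same label identified. -/
def DisplayVertex {V1 V2 X : Type*} (l1 : X → V1) (l2 : X → V2) : Type _ :=
  {u : V1 ⊕ V2 // mergeMap l1 l2 u = u}

/-- The canonical map from `V1 ⊕ V2` to the vertex set of the display graph. -/
noncomputable def toDisplay {V1 V2 X : Type*} (l1 : X → V1) (l2 : X → V2) (u : V1 ⊕ V2) :
    DisplayVertex l1 l2 :=
  ⟨mergeMap l1 l2 u, mergeMap_idem l1 l2 u⟩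

/-- The display graph of two leaf-labelled graphs: their disjoint union with the
leaves carrying the same label identified. -/
noncomputable def displayGraph {V1 V2 X : Type*} (G1 : SimpleGraph V1) (l1 : X → V1)
    (G2 : SimpleGraph V2) (l2 : X → V2) : SimpleGraph (DisplayVertex l1 l2) :=
  SimpleGraph.fromRel (fun a b =>
    (∃ u v : V1, G1.Adj u v ∧ a = toDisplay l1 l2 (Sum.inl u) ∧ b = toDisplay l1 l2 (Sum.inl v)) ∨
    (∃ u v : V2, G2.Adj u v ∧ a = toDisplay l1 l2 (Sum.inr u) ∧ b = toDisplay l1 l2 (Sum.inr v)))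

/-- The treewidth distance between two phylogenetic trees:
`d_tw(T1,T2) = tw(D(T1,T2)) - 2`. -/
noncomputable def dtw {V1 V2 X : Type*} (T1 : PhyloTree V1 X) (T2 : PhyloTree V2 X) : ℕ :=
  treewidth (displayGraph T1.graph T1.leaf T2.graph T2.leaf) - 2

/-- Two phylogenetic trees are compatible if there is a label-preserving
isomorphism between them. -/
def Compatible {V1 V2 X : Type*} (T1 : PhyloTree V1 X) (T2 : PhyloTree V2 X) : Prop :=
  ∃ φ : T1.graph ≃g T2.graph, ∀ x : X, φ (T1.leaf x) = T2.leaf x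

/-- `C = (c 0, ..., c (t-1))` is a chain of `T` of length `t` with parents
`p 0, ..., p (t-1)`: the taxa are distinct, the parents are mutually distinct,
`p i` is the parent of the taxon `c i`, and `(p 0, ..., p (t-1))` is a path. -/
def PhyloChain {V X : Type*} (T : PhyloTree V X) (t : ℕ) (c : Fin t → X) (p : Fin t → V) : Prop :=
  Function.Injective c ∧ Function.Injective p ∧
  (∀ i : Fin t, T.graph.Adj (p i) (T.leaf (c i))) ∧
  (∀ (i : ℕ) (h : i + 1 < t), T.graph.Adj (p ⟨i, Nat.lt_of_succ_lt h⟩) (p ⟨i + 1, h⟩))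

/-- The indices of the taxa of a chain of length `t` kept by the common
`d`-chain reduction: the first `⌈d/2⌉` and the last `⌊d/2⌋` ones. -/
def keepIdx (t d : ℕ) (i : Fin t) : Prop :=
  (i : ℕ) < (d + 1) / 2 ∨ t - d / 2 ≤ (i : ℕ)

/-- `T'` is obtained from `T` by the common `d`-chain reduction applied to the
chain `c` (with parents `p`) of length `t`: the first `⌈d/2⌉` and last `⌊d/2⌋`
taxa of the chain are kept, the intermediate taxa are deleted, the resulting
degree-2 vertices are suppressed (so that the parents of the taxa
`c (⌈d/2⌉ - 1)` and `c (t - ⌊d/2⌋)` become adjacent) and resulting unlabelled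
degree-1 vertices are deleted. -/
def IsClippedChain {V X W : Type*} (T : PhyloTree V X) (t : ℕ) (c : Fin t → X)
    (p : Fin t → V) (d : ℕ)
    (T' : PhyloTree W {x : X // ∀ i : Fin t, ¬ keepIdx t d i → c i ≠ x}) : Prop :=
  ∃ φ : W → V,
    Function.Injective φ ∧
    (∀ y, φ (T'.leaf y) = T.leaf y.1) ∧
    Set.range φ = {v | ∀ i : Fin t, ¬ keepIdx t d i → (T.leaf (c i) ≠ v ∧ p i ≠ v)} ∧
    ∀ a b : W, T'.graph.Adj a b ↔
      (T.graph.Adj (φ a) (φ b) ∨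
        ∃ (h1 : (d + 1) / 2 - 1 < t) (h2 : t - d / 2 < t),
          ((φ a = p ⟨(d + 1) / 2 - 1, h1⟩ ∧ φ b = p ⟨t - d / 2, h2⟩) ∨
           (φ b = p ⟨(d + 1) / 2 - 1, h1⟩ ∧ φ a = p ⟨t - d / 2, h2⟩)))

/-- The vertices of the display graph that are taxa of the common chain `c`. -/
noncomputable def chainTaxaV {V1 V2 X : Type*} (T1 : PhyloTree V1 X) (T2 : PhyloTree V2 X)
    (t : ℕ) (c : Fin t → X) : Set (DisplayVertex T1.leaf T2.leaf) :=
  {u | ∃ i : Fin t, u = toDisplay T1.leaf T2.leaf (Sum.inl (T1.leaf (c i)))}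

/-- The vertex set of the `2 × t` grid `g(C)` of a common chain in the display
graph: the parents of the chain taxa in both trees. -/
noncomputable def gridV {V1 V2 X : Type*} (T1 : PhyloTree V1 X) (T2 : PhyloTree V2 X)
    (t : ℕ) (p : Fin t → V1) (q : Fin t → V2) : Set (DisplayVertex T1.leaf T2.leaf) :=
  {u | ∃ i : Fin t, u = toDisplay T1.leaf T2.leaf (Sum.inl (p i)) ∨
    u = toDisplay T1.leaf T2.leaf (Sum.inr (q i))}

/-- The display graph of `T1` and `T2` in which the degree-2 vertices labelled
by the taxa of the common chain `c` have been suppressed (turning the parents of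
each chain taxon in the two trees into neighbours). -/
noncomputable def chainSuppressedDisplay {V1 V2 X : Type*} (T1 : PhyloTree V1 X)
    (T2 : PhyloTree V2 X) (t : ℕ) (c : Fin t → X) (p : Fin t → V1) (q : Fin t → V2) :
    SimpleGraph {u : DisplayVertex T1.leaf T2.leaf // u ∉ chainTaxaV T1 T2 t c} :=
  SimpleGraph.fromRel (fun a b =>
    (displayGraph T1.graph T1.leaf T2.graph T2.leaf).Adj a.1 b.1 ∨
    ∃ i : Fin t, a.1 = toDisplay T1.leaf T2.leaf (Sum.inl (p i)) ∧
      b.1 = toDisplay T1.leaf T2.leaf (Sum.inr (q i)))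

/-- The grid `g(C)` of the common chain `c` is a separator of the display graph
of `T1` and `T2`: deleting the grid vertices (from the display graph with the
chain taxa suppressed) disconnects it. -/
noncomputable def GridSeparates {V1 V2 X : Type*} (T1 : PhyloTree V1 X) (T2 : PhyloTree V2 X)
    (t : ℕ) (c : Fin t → X) (p : Fin t → V1) (q : Fin t → V2) : Prop :=
  ¬ ((chainSuppressedDisplay T1 T2 t c p q).induce
      {w : {u : DisplayVertex T1.leaf T2.leaf // u ∉ chainTaxaV T1 T2 t c} |
        w.1 ∉ gridV T1 T2 t p q}).Preconnected


/-! ### Connected sets of vertices, described by walks -/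

def JnIn {V : Type*} (G : SimpleGraph V) (S : Set V) (u v : V) : Prop :=
  ∃ w : G.Walk u v, ∀ x ∈ w.support, x ∈ S

def PConn {V : Type*} (G : SimpleGraph V) (S : Set V) : Prop :=
  ∀ u ∈ S, ∀ v ∈ S, JnIn G S u v

lemma JnIn.refl {V : Type*} {G : SimpleGraph V} {S : Set V} {u : V} (h : u ∈ S) :
    JnIn G S u u := ⟨Walk.nil, by simpa using h⟩

lemma JnIn.trans {V : Type*} {G : SimpleGraph V} {S : Set V} {u v w : V}
    (h : JnIn G S u v) (h' : JnIn G S v w) : JnIn G S u w := by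
  obtain ⟨p, hp⟩ := h
  obtain ⟨q, hq⟩ := h'
  refine ⟨p.append q, fun x hx => ?_⟩
  rw [Walk.mem_support_append_iff] at hx
  exact hx.elim (hp x) (hq x)

lemma JnIn.symm {V : Type*} {G : SimpleGraph V} {S : Set V} {u v : V}
    (h : JnIn G S u v) : JnIn G S v u := by
  obtain ⟨p, hp⟩ := h
  exact ⟨p.reverse, fun x hx => hp x (by simpa using hx)⟩

lemma JnIn.mono {V : Type*} {G : SimpleGraph V} {S T : Set V} (hST : S ⊆ T) {u v : V}
    (h : JnIn G S u v) : JnIn G T u v := by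
  obtain ⟨p, hp⟩ := h
  exact ⟨p, fun x hx => hST (hp x hx)⟩

lemma JnIn.of_adj {V : Type*} {G : SimpleGraph V} {S : Set V} {u v : V}
    (hu : u ∈ S) (hv : v ∈ S) (h : G.Adj u v) : JnIn G S u v := by
  refine ⟨Walk.cons h Walk.nil, fun x hx => ?_⟩
  simp at hx
  rcases hx with rfl | rfl <;> assumption

lemma JnIn.map {V V' : Type*} {G : SimpleGraph V} {G' : SimpleGraph V'} {S : Set V}
    {T : Set V'} (f : G →g G') (hf : ∀ x ∈ S, f x ∈ T) {u v : V} (h : JnIn G S u v) :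
    JnIn G' T (f u) (f v) := by
  obtain ⟨p, hp⟩ := h
  refine ⟨p.map f, fun x hx => ?_⟩
  rw [Walk.support_map, List.mem_map] at hx
  obtain ⟨y, hy, rfl⟩ := hx
  exact hf y (hp y hy)

lemma pconn_of_base {V : Type*} {G : SimpleGraph V} {S : Set V} (b : V)
    (h : ∀ u ∈ S, JnIn G S u b) : PConn G S :=
  fun u hu v hv => (h u hu).trans (h v hv).symm

lemma pconn_iff {V : Type*} {G : SimpleGraph V} {S : Set V} :
    (G.induce S).Preconnected ↔ PConn G S := by
  constructor
  · intro h u hu v hv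
    obtain ⟨w⟩ := h ⟨u, hu⟩ ⟨v, hv⟩
    exact JnIn.map (S := Set.univ) (Embedding.induce S).toHom (fun x _ => x.2)
      ⟨w, fun _ _ => trivial⟩
  · rintro h ⟨u, hu⟩ ⟨v, hv⟩
    obtain ⟨w, hw⟩ := h u hu v hv
    exact ⟨w.induce S hw⟩

lemma PConn.union {V : Type*} {G : SimpleGraph V} {S T : Set V} (hS : PConn G S)
    (hT : PConn G T) {z : V} (hzS : z ∈ S) (hzT : z ∈ T) : PConn G (S ∪ T) := by
  apply pconn_of_base z
  rintro u (hu | hu)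
  · exact (hS u hu z hzS).mono Set.subset_union_left
  · exact (hT u hu z hzT).mono Set.subset_union_right

/-- Gate lemma for subtrees of a tree. -/
lemma exists_gate {I : Type*} {t : SimpleGraph I} (ht : t.IsTree) {S : Set I} (hS : PConn t S)
    {s0 : I} (hs0 : s0 ∈ S) (z : I) :
    ∃ g ∈ S, ∀ s ∈ S, ∀ w : t.Walk z s, g ∈ w.support := by
  obtain ⟨w0⟩ := ht.1 z s0
  induction w0 with
  | nil => exact ⟨_, hs0, fun s _ w => w.start_mem_support⟩
  | @cons z z' s0 hadj w0 ih =>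
    by_cases hz : z ∈ S
    · exact ⟨z, hz, fun s _ w => w.start_mem_support⟩
    obtain ⟨g, hg, hgs⟩ := ih hs0
    refine ⟨g, hg, fun s hs w => ?_⟩
    by_cases hgz : g = z'
    · subst hgz
      by_contra hcon
      obtain ⟨q, hq⟩ := hS s hs g hg
      have hb := isAcyclic_iff_forall_adj_isBridge.1 ht.2 hadj
      have := isBridge_iff_forall_walk_mem_edges.1 hb (w.append q)
      rw [Walk.edges_append, List.mem_append] at this
      rcases this with h | h
      · exact hcon (w.snd_mem_support_of_mem_edges h)
      · exact hz (hq _ (q.fst_mem_support_of_mem_edges h))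
    · have := hgs s hs (Walk.cons hadj.symm w)
      rw [Walk.support_cons, List.mem_cons] at this
      exact this.resolve_left hgz

lemma helly3 {I : Type*} {t : SimpleGraph I} (ht : t.IsTree) {A B C : Set I}
    (hA : PConn t A) (hB : PConn t B) (hC : PConn t C)
    (hAB : (A ∩ B).Nonempty) (hAC : (A ∩ C).Nonempty) (hBC : (B ∩ C).Nonempty) :
    (A ∩ B ∩ C).Nonempty := by
  obtain ⟨x, hxA, hxB⟩ := hAB
  obtain ⟨y, hyA, hyC⟩ := hAC
  obtain ⟨z, hzB, hzC⟩ := hBC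
  obtain ⟨g, hg, hgs⟩ := exists_gate ht hA hxA z
  obtain ⟨w1, hw1⟩ := hB z hzB x hxB
  obtain ⟨w2, hw2⟩ := hC z hzC y hyC
  exact ⟨g, ⟨hg, hw1 _ (hgs x hxA w1)⟩, hw2 _ (hgs y hyA w2)⟩

lemma PConn.inter {I : Type*} {t : SimpleGraph I} (ht : t.IsTree) {A B : Set I}
    (hA : PConn t A) (hB : PConn t B) : PConn t (A ∩ B) := by
  classical
  rintro u ⟨huA, huB⟩ v ⟨hvA, hvB⟩
  obtain ⟨p, hp⟩ := hA u huA v hvA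
  obtain ⟨q, hq⟩ := hB u huB v hvB
  have : p.toPath = q.toPath := (ht.2.subsingleton_path _ _).elim _ _
  refine ⟨p.toPath, fun x hx => ⟨hp x (Walk.support_bypass_subset_support _ hx), ?_⟩⟩
  rw [this] at hx
  exact hq x (Walk.support_bypass_subset_support _ hx)

lemma helly4 {I : Type*} {t : SimpleGraph I} (ht : t.IsTree) {A B C D : Set I}
    (hA : PConn t A) (hB : PConn t B) (hC : PConn t C) (hD : PConn t D)
    (hAB : (A ∩ B).Nonempty) (hAC : (A ∩ C).Nonempty) (hBC : (B ∩ C).Nonempty)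
    (hAD : (A ∩ D).Nonempty) (hBD : (B ∩ D).Nonempty) (hCD : (C ∩ D).Nonempty) :
    (A ∩ B ∩ (C ∩ D)).Nonempty := by
  apply helly3 ht hA hB (hC.inter ht hD) hAB
  · rw [← Set.inter_assoc]; exact helly3 ht hA hC hD hAC hAD hCD
  · rw [← Set.inter_assoc]; exact helly3 ht hB hC hD hBC hBD hCD

/-! ### Families of bags realised by a tree -/

structure TDw {V : Type*} (k : ℕ) {I : Type} (t : SimpleGraph I) (bag : I → Finset V) :
    Prop where
  tree : t.IsTree
  pc : ∀ v, PConn t {i | v ∈ bag i}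
  card : ∀ i, (bag i).card ≤ k + 1

def BagFam {V : Type*} (k : ℕ) (F : Set (Finset V)) : Prop :=
  ∃ (I : Type) (_ : Finite I) (t : SimpleGraph I) (bag : I → Finset V),
    TDw k t bag ∧ Set.range bag = F

def Cv {V : Type*} (F : Set (Finset V)) (u v : V) : Prop := ∃ B ∈ F, u ∈ B ∧ v ∈ B

lemma Cv.symm {V : Type*} {F : Set (Finset V)} {u v : V} (h : Cv F u v) : Cv F v u := by
  obtain ⟨B, hB, h1, h2⟩ := h
  exact ⟨B, hB, h2, h1⟩

lemma Cv.mono {V : Type*} {F F' : Set (Finset V)} (hF : F ⊆ F') {u v : V} (h : Cv F u v) :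
    Cv F' u v := by
  obtain ⟨B, hB, h1, h2⟩ := h
  exact ⟨B, hF hB, h1, h2⟩

lemma has_of_fam {V : Type*} {G : SimpleGraph V} {k : ℕ} {F : Set (Finset V)}
    (h : BagFam k F) (hv : ∀ v, Cv F v v) (he : ∀ u v, G.Adj u v → Cv F u v) :
    HasTreeDecompWidthLE G k := by
  obtain ⟨I, hI, t, bag, htd, rfl⟩ := h
  have : Nonempty I := htd.tree.1.nonempty
  obtain ⟨n, ⟨e⟩⟩ := Finite.exists_equiv_fin I
  obtain ⟨m, rfl⟩ : ∃ m, n = m + 1 := by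
    cases n with
    | zero => exact (e (Classical.arbitrary I)).elim0
    | succ m => exact ⟨m, rfl⟩
  let φ : t ≃g t.map e.toEmbedding := Iso.map e t
  refine ⟨m, t.map e.toEmbedding, fun i => bag (e.symm i), ?_, ?_, ?_, ?_, ?_⟩
  · exact (Iso.isTree_iff φ).1 htd.tree
  · intro v
    obtain ⟨_, ⟨i, rfl⟩, h1, h2⟩ := hv v
    exact ⟨e i, by simpa using h1⟩
  · intro u v huv
    obtain ⟨_, ⟨i, rfl⟩, h1, h2⟩ := he u v huv
    exact ⟨e i, by simpa using h1, by simpa using h2⟩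
  · intro v
    have : Nonempty {i : Fin (m + 1) | v ∈ bag (e.symm i)} := by
      obtain ⟨_, ⟨i, rfl⟩, h1, h2⟩ := hv v
      exact ⟨⟨e i, by simpa using h1⟩⟩
    refine ⟨pconn_iff.2 ?_⟩
    intro i hi j hj
    have hh : JnIn (t.map e.toEmbedding) {i | v ∈ bag (e.symm i)} (e (e.symm i))
        (e (e.symm j)) := by
      refine JnIn.map φ.toHom (fun y hy => ?_) (htd.pc v (e.symm i) hi (e.symm j) hj)
      have : e.symm (φ y) = y := e.symm_apply_apply y
      show v ∈ bag (e.symm (φ y))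
      rw [this]
      exact hy
    simpa using hh
  · intro i
    exact htd.card _

lemma fam_of_has {V : Type*} {G : SimpleGraph V} {k : ℕ} (h : HasTreeDecompWidthLE G k) :
    ∃ F : Set (Finset V), BagFam k F ∧ (∀ v, Cv F v v) ∧ ∀ u v, G.Adj u v → Cv F u v := by
  obtain ⟨n, t, bag, h1, h2, h3, h4, h5⟩ := h
  refine ⟨Set.range bag, ⟨_, inferInstance, t, bag, ⟨h1, fun v => ?_, h5⟩, rfl⟩, ?_, ?_⟩
  · exact pconn_iff.1 (h4 v).preconnected
  · intro v
    obtain ⟨i, hi⟩ := h2 v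
    exact ⟨_, ⟨i, rfl⟩, hi, hi⟩
  · intro u v huv
    obtain ⟨i, hi, hj⟩ := h3 u v huv
    exact ⟨_, ⟨i, rfl⟩, hi, hj⟩

/-- The union of the supports of a connected set of vertices is connected. -/
lemma pconn_support {V : Type*} {G : SimpleGraph V} {I : Type} {t : SimpleGraph I}
    {bag : I → Finset V} {S : Set V} (hpc : ∀ v, PConn t {i | v ∈ bag i}) (hS : PConn G S)
    (he : ∀ u ∈ S, ∀ v ∈ S, G.Adj u v → Cv (Set.range bag) u v) :
    PConn t {i | ∃ v ∈ S, v ∈ bag i} := by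
  rintro i ⟨u, hu, hui⟩ j ⟨v, hv, hvj⟩
  obtain ⟨w, hw⟩ := hS u hu v hv
  have hsub : ∀ u ∈ S, {i | u ∈ bag i} ⊆ {i | ∃ v ∈ S, v ∈ bag i} :=
    fun u hu i hi => ⟨u, hu, hi⟩
  induction w generalizing i with
  | nil => exact (hpc _ i hui j hvj).mono (hsub _ hu)
  | @cons u u' v hadj w ih =>
    have hu' : u' ∈ S := hw u' (by simp)
    obtain ⟨_, ⟨m, rfl⟩, hm1, hm2⟩ := he u hu u' hu' hadj
    refine ((hpc u i hui m hm1).mono (hsub _ hu)).trans (ih m hu' hm2 hv hvj ?_)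
    exact fun x hx => hw x (by simp [hx])

/-- Contracting connected fibres. -/
lemma BagFam.image {V V' : Type*} [DecidableEq V'] {G : SimpleGraph V} {k : ℕ}
    {F : Set (Finset V)} (h : BagFam k F) (he : ∀ u v, G.Adj u v → Cv F u v) (f : V → V')
    (hf : ∀ y, PConn G {v | f v = y}) : BagFam k ((fun B => B.image f) '' F) := by
  obtain ⟨I, hI, t, bag, htd, rfl⟩ := h
  refine ⟨I, hI, t, fun i => (bag i).image f, ⟨htd.tree, fun y => ?_, fun i => ?_⟩, ?_⟩
  · have := pconn_support htd.pc (hf y) (fun u _ v _ huv => he u v huv)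
    convert this using 2
    ext i
    simp only [Finset.mem_image, Set.mem_ofPred_eq]
    constructor
    · rintro ⟨a, h1, h2⟩; exact ⟨a, h2, h1⟩
    · rintro ⟨a, h1, h2⟩; exact ⟨a, h2, h1⟩
  · exact Finset.card_image_le.trans (htd.card i)
  · rw [← Set.range_comp]; rfl

lemma Cv.image {V V' : Type*} [DecidableEq V'] {F : Set (Finset V)} {u v : V} (h : Cv F u v)
    (f : V → V') : Cv ((fun B => B.image f) '' F) (f u) (f v) := by
  obtain ⟨B, hB, h1, h2⟩ := h
  exact ⟨_, ⟨B, hB, rfl⟩, Finset.mem_image_of_mem f h1, Finset.mem_image_of_mem f h2⟩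

/-- Adding one vertex to all bags. -/
lemma BagFam.insert_all {V : Type*} [DecidableEq V] {k : ℕ}
    {F : Set (Finset V)} (h : BagFam k F) (a : V) :
    BagFam (k + 1) ((fun B => insert a B) '' F) := by
  obtain ⟨I, hI, t, bag, htd, rfl⟩ := h
  refine ⟨I, hI, t, fun i => insert a (bag i), ⟨htd.tree, fun y => ?_, fun i => ?_⟩, ?_⟩
  · by_cases hy : y = a
    · subst hy
      intro u _ v _
      obtain ⟨w⟩ := htd.tree.1 u v
      exact ⟨w, fun x _ => by simp⟩
    · have := htd.pc y
      convert this using 2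
      ext i
      simp [hy]
  · have := Finset.card_insert_le a (bag i)
    have := htd.card i
    omega
  · rw [← Set.range_comp]; rfl

/-- Attaching a pendant vertex to a graph. -/
def pend {I : Type} (t : SimpleGraph I) (i0 : I) : SimpleGraph (Option I) where
  Adj a b := match a, b with
    | some i, some j => t.Adj i j
    | some i, none => i = i0
    | none, some j => j = i0
    | none, none => False
  symm := ⟨by
    intro a b h
    cases a <;> cases b <;> simp_all [SimpleGraph.adj_comm]⟩
  loopless := ⟨by
    intro a h
    cases a <;> simp_all⟩

def pendHom {I : Type} (t : SimpleGraph I) (i0 : I) : t →g pend t i0 where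
  toFun := some
  map_rel' := fun h => h

lemma pend_proj {I : Type} {t : SimpleGraph I} {i0 : I} {a b : Option I}
    (w : (pend t i0).Walk a b) :
    ∃ w' : t.Walk (a.getD i0) (b.getD i0), ∀ u v : I, s(u, v) ∈ w'.edges →
      s(some u, some v) ∈ w.edges := by
  induction w with
  | nil => exact ⟨Walk.nil, by simp⟩
  | @cons a b c hadj w ih =>
    obtain ⟨w', hw'⟩ := ih
    rcases a with _ | a <;> rcases b with _ | b
    · exact hadj.elim
    · have hb : b = i0 := hadj
      subst hb
      exact ⟨w', fun u v h => by simp [hw' u v h]⟩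
    · have hb : a = i0 := hadj
      subst hb
      exact ⟨w', fun u v h => by simp [hw' u v h]⟩
    · refine ⟨Walk.cons (show t.Adj a b from hadj) w', fun u v h => ?_⟩
      rw [Walk.edges_cons, List.mem_cons] at h ⊢
      rcases h with h | h
      · left
        have := congrArg (Sym2.map some) h
        simpa using this
      · right; exact hw' u v h

lemma pend_none_edge {I : Type} {t : SimpleGraph I} {i0 : I} {b : Option I}
    (w : (pend t i0).Walk none b) (hb : b ≠ none) : s(none, some i0) ∈ w.edges := by
  cases w with
  | nil => exact absurd rfl hb
  | @cons a c b hadj w =>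
    rcases c with _ | c
    · exact hadj.elim
    · have hc : c = i0 := hadj
      subst hc
      simp

lemma pend_isTree {I : Type} {t : SimpleGraph I} (ht : t.IsTree) (i0 : I) :
    (pend t i0).IsTree := by
  constructor
  · have : Nonempty (Option I) := ⟨none⟩
    refine ⟨?_⟩
    have key : ∀ a : Option I, (pend t i0).Reachable a (some i0) := by
      intro a
      rcases a with _ | a
      · exact Adj.reachable (show (pend t i0).Adj none (some i0) from rfl)
      · exact (ht.1 a i0).map (pendHom t i0)
    exact fun a b => (key a).trans (key b).symm
  · rw [isAcyclic_iff_forall_adj_isBridge]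
    intro a b hadj
    rw [isBridge_iff_forall_walk_mem_edges]
    intro w
    rcases a with _ | a <;> rcases b with _ | b
    · exact hadj.elim
    · have hb : b = i0 := hadj
      subst hb
      exact pend_none_edge w (by simp)
    · have hb : a = i0 := hadj
      subst hb
      have := pend_none_edge w.reverse (by simp)
      rw [Walk.edges_reverse, List.mem_reverse] at this
      rw [Sym2.eq_swap]; exact this
    · obtain ⟨w', hw'⟩ := pend_proj w
      apply hw'
      have hb := isAcyclic_iff_forall_adj_isBridge.1 ht.2 (show t.Adj a b from hadj)
      exact isBridge_iff_forall_walk_mem_edges.1 hb w'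

lemma BagFam.add_bag {V : Type*} {k : ℕ} {F : Set (Finset V)} (h : BagFam k F)
    {B0 : Finset V} (hB0 : B0 ∈ F) (B : Finset V)
    (hB : ∀ v ∈ B, v ∈ B0 ∨ ∀ C ∈ F, v ∉ C) (hc : B.card ≤ k + 1) :
    BagFam k (insert B F) := by
  obtain ⟨I, hI, t, bag, htd, rfl⟩ := h
  obtain ⟨i0, rfl⟩ := hB0
  refine ⟨Option I, inferInstance, pend t i0, fun o => o.elim B bag,
    ⟨pend_isTree htd.tree i0, fun v => ?_, fun i => ?_⟩, ?_⟩
  · have hsome : ∀ i j, v ∈ bag i → v ∈ bag j →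
        JnIn (pend t i0) {o : Option I | v ∈ (o.elim B bag : Finset V)} (some i) (some j) := by
      intro i j hi hj
      exact JnIn.map (pendHom t i0) (fun y hy => hy) (htd.pc v i hi j hj)
    by_cases hvB : v ∈ B
    · apply pconn_of_base none
      intro o ho
      rcases o with _ | i
      · exact JnIn.refl ho
      · have hi : v ∈ bag i := ho
        have h0 : v ∈ bag i0 := by
          rcases hB v hvB with h | h
          · exact h
          · exact absurd hi (h _ ⟨i, rfl⟩)
        exact (hsome i i0 hi h0).trans (JnIn.of_adj h0 hvB (show (pend t i0).Adj _ _ from rfl))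
    · intro o ho o' ho'
      rcases o with _ | i
      · exact absurd ho hvB
      rcases o' with _ | j
      · exact absurd ho' hvB
      exact hsome i j ho ho'
  · rcases i with _ | i
    · exact hc
    · exact htd.card i
  · ext C
    simp only [Set.mem_range, Set.mem_insert_iff]
    constructor
    · rintro ⟨_ | i, rfl⟩
      · exact Or.inl rfl
      · exact Or.inr ⟨i, rfl⟩
    · rintro (rfl | ⟨i, rfl⟩)
      · exact ⟨none, rfl⟩
      · exact ⟨some i, rfl⟩

/-! ### The abstract chain reduction -/

def OutS {V : Type*} (L : ℕ) (P Q x : ℕ → V) : Set V :=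
  {v | ∀ i ≤ L, v ≠ P i ∧ v ≠ Q i ∧ v ≠ x i}

structure ChainRed {V V' : Type*} (D : SimpleGraph V) (D' : SimpleGraph V') (ψ : V' → V)
    (L : ℕ) (P Q x : ℕ → V) : Prop where
  hL : 2 ≤ L
  inj : Function.Injective ψ
  rng : ∀ v, (∃ a, ψ a = v) ↔ ∀ i, 0 < i → i < L → v ≠ P i ∧ v ≠ Q i ∧ v ≠ x i
  adj' : ∀ a b, D'.Adj a b ↔ D.Adj (ψ a) (ψ b) ∨
    (ψ a = P 0 ∧ ψ b = P L) ∨ (ψ b = P 0 ∧ ψ a = P L) ∨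
    (ψ a = Q 0 ∧ ψ b = Q L) ∨ (ψ b = Q 0 ∧ ψ a = Q L)
  Pinj : ∀ i ≤ L, ∀ j ≤ L, P i = P j → i = j
  Qinj : ∀ i ≤ L, ∀ j ≤ L, Q i = Q j → i = j
  xinj : ∀ i ≤ L, ∀ j ≤ L, x i = x j → i = j
  PQ : ∀ i ≤ L, ∀ j ≤ L, P i ≠ Q j
  Px : ∀ i ≤ L, ∀ j ≤ L, P i ≠ x j
  Qx : ∀ i ≤ L, ∀ j ≤ L, Q i ≠ x j
  aPx : ∀ i ≤ L, D.Adj (P i) (x i)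
  aQx : ∀ i ≤ L, D.Adj (Q i) (x i)
  aPP : ∀ i < L, D.Adj (P i) (P (i + 1))
  aQQ : ∀ i < L, D.Adj (Q i) (Q (i + 1))
  nx : ∀ i ≤ L, ∀ v, D.Adj (x i) v → v = P i ∨ v = Q i
  nP : ∀ i, 0 < i → i < L → ∀ v, D.Adj (P i) v → v = P (i - 1) ∨ v = P (i + 1) ∨ v = x i
  nQ : ∀ i, 0 < i → i < L → ∀ v, D.Adj (Q i) v → v = Q (i - 1) ∨ v = Q (i + 1) ∨ v = x i
  conn : PConn D (OutS L P Q x)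
  eP0 : ∃ v ∈ OutS L P Q x, D.Adj (P 0) v
  ePL : ∃ v ∈ OutS L P Q x, D.Adj (P L) v
  eQ0 : ∃ v ∈ OutS L P Q x, D.Adj (Q 0) v
  eQL : ∃ v ∈ OutS L P Q x, D.Adj (Q L) v

lemma ChainRed.minor {V V' : Type*} {D : SimpleGraph V} {D' : SimpleGraph V'} {ψ : V' → V}
    {L : ℕ} {P Q x : ℕ → V} (h : ChainRed D D' ψ L P Q x) {k : ℕ}
    (hD : HasTreeDecompWidthLE D k) : HasTreeDecompWidthLE D' k := by
  classical
  have hL := h.hL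
  obtain ⟨F, hF, hv, he⟩ := fam_of_has hD
  let g : V → V := fun v =>
    if ∃ i, 0 < i ∧ i < L ∧ (v = P i ∨ v = x i) then P 0
    else if ∃ i, 0 < i ∧ i < L ∧ v = Q i then Q 0 else v
  have gP : ∀ i, i < L → g (P i) = P 0 := by
    intro i hi
    rcases Nat.eq_zero_or_pos i with rfl | h0
    · have h1 : ¬ ∃ i, 0 < i ∧ i < L ∧ (P 0 = P i ∨ P 0 = x i) := by
        rintro ⟨i, h0, h1, h2 | h2⟩
        · have := h.Pinj 0 (by omega) i (by omega) h2
          omega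
        · exact h.Px 0 (by omega) i (by omega) h2
      have h2 : ¬ ∃ i, 0 < i ∧ i < L ∧ P 0 = Q i := by
        rintro ⟨i, h0, h1, h2⟩
        exact h.PQ 0 (by omega) i (by omega) h2
      simp only [g, if_neg h1, if_neg h2]
    · exact if_pos ⟨i, h0, hi, Or.inl rfl⟩
  have gx : ∀ i, 0 < i → i < L → g (x i) = P 0 := fun i h0 hi =>
    if_pos ⟨i, h0, hi, Or.inr rfl⟩
  have gQ : ∀ i, i < L → g (Q i) = Q 0 := by
    intro i hi
    have h1 : ¬ ∃ j, 0 < j ∧ j < L ∧ (Q i = P j ∨ Q i = x j) := by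
      rintro ⟨j, h0, h1, h2 | h2⟩
      · exact h.PQ j (by omega) i (by omega) h2.symm
      · exact h.Qx i (by omega) j (by omega) h2
    rcases Nat.eq_zero_or_pos i with rfl | h0
    · simp only [g, if_neg h1]
      split_ifs <;> rfl
    · simp only [g, if_neg h1]
      exact if_pos ⟨i, h0, hi, rfl⟩
  have gid : ∀ a, g (ψ a) = ψ a := by
    intro a
    have hr := (h.rng (ψ a)).1 ⟨a, rfl⟩
    have h1 : ¬ ∃ i, 0 < i ∧ i < L ∧ (ψ a = P i ∨ ψ a = x i) := by
      rintro ⟨i, h0, h1, h2 | h2⟩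
      · exact (hr i h0 h1).1 h2
      · exact (hr i h0 h1).2.2 h2
    have h2 : ¬ ∃ i, 0 < i ∧ i < L ∧ ψ a = Q i := by
      rintro ⟨i, h0, h1, h2⟩
      exact (hr i h0 h1).2.1 h2
    simp only [g, if_neg h1, if_neg h2]
  have gcase : ∀ v, g v = v ∨ (∃ i, 0 < i ∧ i < L ∧ (v = P i ∨ v = x i)) ∨
      (∃ i, 0 < i ∧ i < L ∧ v = Q i) := by
    intro v
    by_cases h1 : ∃ i, 0 < i ∧ i < L ∧ (v = P i ∨ v = x i)
    · exact Or.inr (Or.inl h1)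
    by_cases h2 : ∃ i, 0 < i ∧ i < L ∧ v = Q i
    · exact Or.inr (Or.inr h2)
    left
    simp only [g, if_neg h1, if_neg h2]
  have hP0 : ∃ a, ψ a = P 0 := (h.rng _).2 fun i h0 hi =>
    ⟨fun e => by have := h.Pinj 0 (by omega) i (by omega) e; omega,
      h.PQ 0 (by omega) i (by omega), h.Px 0 (by omega) i (by omega)⟩
  have hQ0 : ∃ a, ψ a = Q 0 := (h.rng _).2 fun i h0 hi =>
    ⟨fun e => h.PQ i (by omega) 0 (by omega) e.symm,
      fun e => by have := h.Qinj 0 (by omega) i (by omega) e; omega, h.Qx 0 (by omega) i (by omega)⟩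
  have hg : ∀ v, ∃ a, ψ a = g v := by
    intro v
    rcases gcase v with h1 | ⟨i, h0, hi, rfl | rfl⟩ | ⟨i, h0, hi, rfl⟩
    · rw [h1, h.rng]
      intro i h0 hi
      refine ⟨?_, ?_, ?_⟩
      · rintro rfl
        rw [gP i hi] at h1
        have := h.Pinj 0 (by omega) i (by omega) h1; omega
      · rintro rfl
        rw [gQ i hi] at h1
        have := h.Qinj 0 (by omega) i (by omega) h1; omega
      · rintro rfl
        rw [gx i h0 hi] at h1
        exact h.Px 0 (by omega) i (by omega) h1
    · rw [gP i hi]; exact hP0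
    · rw [gx i h0 hi]; exact hP0
    · rw [gQ i hi]; exact hQ0
  choose f hf using hg
  have fψ : ∀ a, f (ψ a) = a := fun a => h.inj ((hf _).trans (gid a))
  have hfib : ∀ y, PConn D {v | f v = y} := by
    intro y
    have hfib' : {v | f v = y} = {v | g v = ψ y} := by
      ext v
      simp only [Set.mem_ofPred_eq]
      rw [← hf v]
      exact ⟨fun e => by rw [e], fun e => h.inj e⟩
    rw [hfib']
    apply pconn_of_base (ψ y)
    intro v hv'
    have hv' : g v = ψ y := hv'
    have hPi : ψ y = P 0 → ∀ i, i < L → JnIn D {v | g v = ψ y} (P i) (P 0) := by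
      intro hy i
      induction i with
      | zero => intro hi; exact JnIn.refl ((gP 0 hi).trans hy.symm)
      | succ i ih =>
        intro hi
        exact (JnIn.of_adj (S := {v | g v = ψ y}) ((gP _ hi).trans hy.symm)
          ((gP i (by omega)).trans hy.symm) (h.aPP i (by omega)).symm).trans (ih (by omega))
    have hQi : ψ y = Q 0 → ∀ i, i < L → JnIn D {v | g v = ψ y} (Q i) (Q 0) := by
      intro hy i
      induction i with
      | zero => intro hi; exact JnIn.refl ((gQ 0 hi).trans hy.symm)
      | succ i ih =>
        intro hi
        exact (JnIn.of_adj (S := {v | g v = ψ y}) ((gQ _ hi).trans hy.symm)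
          ((gQ i (by omega)).trans hy.symm) (h.aQQ i (by omega)).symm).trans (ih (by omega))
    rcases gcase v with h1 | ⟨i, h0, hi, rfl | rfl⟩ | ⟨i, h0, hi, rfl⟩
    · have : v = ψ y := h1.symm.trans hv'
      subst this
      exact JnIn.refl hv'
    · have hy : ψ y = P 0 := by rw [← hv', gP i hi]
      have := hPi hy i hi
      rwa [← hy] at this
    · have hy : ψ y = P 0 := by rw [← hv', gx i h0 hi]
      have := hPi hy i hi
      have h2 : JnIn D {v | g v = ψ y} (x i) (P 0) :=
        (JnIn.of_adj (S := {v | g v = ψ y}) hv' ((gP i hi).trans hy.symm) (h.aPx i hi.le).symm).trans this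
      rwa [← hy] at h2
    · have hy : ψ y = Q 0 := by rw [← hv', gQ i hi]
      have := hQi hy i hi
      rwa [← hy] at this
  have hPL : Cv F (P (L - 1)) (P L) := by
    have := h.aPP (L - 1) (by omega)
    rw [show L - 1 + 1 = L by omega] at this
    exact he _ _ this
  have hQL : Cv F (Q (L - 1)) (Q L) := by
    have := h.aQQ (L - 1) (by omega)
    rw [show L - 1 + 1 = L by omega] at this
    exact he _ _ this
  have fP : ∀ a, ψ a = P 0 → f (P (L - 1)) = a := fun a ha =>
    h.inj (by rw [hf, gP _ (by omega), ha])
  have fQ : ∀ a, ψ a = Q 0 → f (Q (L - 1)) = a := fun a ha =>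
    h.inj (by rw [hf, gQ _ (by omega), ha])
  have cP : ∀ a b, ψ a = P 0 → ψ b = P L → Cv ((fun B => B.image f) '' F) a b := by
    intro a b ha hb
    have := hPL.image f
    rwa [fP a ha, ← hb, fψ] at this
  have cQ : ∀ a b, ψ a = Q 0 → ψ b = Q L → Cv ((fun B => B.image f) '' F) a b := by
    intro a b ha hb
    have := hQL.image f
    rwa [fQ a ha, ← hb, fψ] at this
  refine has_of_fam (hF.image he f hfib) ?_ ?_
  · intro a
    have := (hv (ψ a)).image f
    rwa [fψ] at this
  · intro a b hab
    rcases (h.adj' a b).1 hab with h1 | ⟨h1, h2⟩ | ⟨h1, h2⟩ | ⟨h1, h2⟩ | ⟨h1, h2⟩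
    · have := (he _ _ h1).image f
      rwa [fψ, fψ] at this
    · exact cP a b h1 h2
    · exact (cP b a h1 h2).symm
    · exact cQ a b h1 h2
    · exact (cQ b a h1 h2).symm

/-- The reduced graph yields a family of bags on the vertices of the original graph. -/
lemma ChainRed.fam1 {V V' : Type*} [DecidableEq V] {D : SimpleGraph V} {D' : SimpleGraph V'}
    {ψ : V' → V}
    {L : ℕ} {P Q x : ℕ → V} (h : ChainRed D D' ψ L P Q x) {k : ℕ}
    (hD : HasTreeDecompWidthLE D' k) :
    ∃ F : Set (Finset V), BagFam k F ∧
      (∀ B ∈ F, ∀ v ∈ B, ∀ i ≤ L, v ≠ x i ∧ (0 < i → i < L → v ≠ P i ∧ v ≠ Q i)) ∧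
      (∀ v, (∀ i ≤ L, v ≠ x i ∧ (0 < i → i < L → v ≠ P i ∧ v ≠ Q i)) → Cv F v v) ∧
      (∀ u v, (∀ i ≤ L, u ≠ x i ∧ (0 < i → i < L → u ≠ P i ∧ u ≠ Q i)) →
        (∀ i ≤ L, v ≠ x i ∧ (0 < i → i < L → v ≠ P i ∧ v ≠ Q i)) → D.Adj u v → Cv F u v) ∧
      Cv F (P 0) (Q 0) ∧ Cv F (P L) (Q L) ∧ Cv F (P 0) (P L) ∧ Cv F (Q 0) (Q L) := by
  have hL := h.hL
  obtain ⟨F, hF, hv, he⟩ := fam_of_has hD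
  let f : V' → V := fun a => if ψ a = x 0 then P 0 else if ψ a = x L then P L else ψ a
  have x0L : x L ≠ x 0 := fun e => by
    have := h.xinj L le_rfl 0 (by omega) e; omega
  have f0 : ∀ a, ψ a = x 0 → f a = P 0 := fun a ha => if_pos ha
  have fL : ∀ a, ψ a = x L → f a = P L := fun a ha => by
    simp only [f, ha, if_neg x0L]; simp
  have fo : ∀ a, ψ a ≠ x 0 → ψ a ≠ x L → f a = ψ a := fun a h0 h1 => by
    simp only [f, if_neg h0, if_neg h1]
  have hfib : ∀ y, PConn D' {a | f a = y} := by
    intro y a ha b hb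
    have key : ∀ a b, f a = y → f b = y → D.Adj (ψ a) (ψ b) → JnIn D' {a | f a = y} a b :=
      fun a b ha hb hab => JnIn.of_adj ha hb ((h.adj' a b).2 (Or.inl hab))
    have same : ψ a = ψ b → JnIn D' {a | f a = y} a b := fun e => by
      rw [h.inj e]; exact JnIn.refl hb
    have ha' : f a = y := ha
    have hb' : f b = y := hb
    have hab : f a = f b := ha'.trans hb'.symm
    have hne : P 0 ≠ P L := fun e => by
      have := h.Pinj 0 (by omega) L le_rfl e; omega
    by_cases a0 : ψ a = x 0
    · by_cases b0 : ψ b = x 0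
      · exact same (a0.trans b0.symm)
      by_cases bL : ψ b = x L
      · rw [f0 a a0, fL b bL] at hab; exact absurd hab hne
      · rw [f0 a a0, fo b b0 bL] at hab
        apply key a b ha' hb'
        rw [a0, ← hab]
        exact (h.aPx 0 (by omega)).symm
    by_cases aL : ψ a = x L
    · by_cases b0 : ψ b = x 0
      · rw [f0 b b0, fL a aL] at hab; exact absurd hab.symm hne
      by_cases bL : ψ b = x L
      · exact same (aL.trans bL.symm)
      · rw [fL a aL, fo b b0 bL] at hab
        apply key a b ha' hb'
        rw [aL, ← hab]
        exact (h.aPx L le_rfl).symm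
    · by_cases b0 : ψ b = x 0
      · rw [fo a a0 aL, f0 b b0] at hab
        apply key a b ha' hb'
        rw [b0, hab]
        exact h.aPx 0 (by omega)
      by_cases bL : ψ b = x L
      · rw [fo a a0 aL, fL b bL] at hab
        apply key a b ha' hb'
        rw [bL, hab]
        exact h.aPx L le_rfl
      · rw [fo a a0 aL, fo b b0 bL] at hab
        exact same hab
  have good : ∀ v, (∀ i ≤ L, v ≠ x i ∧ (0 < i → i < L → v ≠ P i ∧ v ≠ Q i)) →
      ∃ a, ψ a = v ∧ f a = v := by
    intro v hv
    obtain ⟨a, ha⟩ := (h.rng v).2 fun i h0 hi =>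
      ⟨((hv i hi.le).2 h0 hi).1, ((hv i hi.le).2 h0 hi).2, (hv i hi.le).1⟩
    refine ⟨a, ha, ?_⟩
    rw [fo a (by rw [ha]; exact (hv 0 (by omega)).1) (by rw [ha]; exact (hv L le_rfl).1), ha]
  have gP : ∀ j, j = 0 ∨ j = L → ∀ i ≤ L, P j ≠ x i ∧ (0 < i → i < L → P j ≠ P i ∧ P j ≠ Q i) := by
    intro j hj i hi
    refine ⟨h.Px j (by omega) i hi, fun h0 h1 => ⟨fun e => ?_, h.PQ j (by omega) i hi⟩⟩
    have := h.Pinj j (by omega) i hi e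
    omega
  have gQ : ∀ j, j = 0 ∨ j = L → ∀ i ≤ L, Q j ≠ x i ∧ (0 < i → i < L → Q j ≠ P i ∧ Q j ≠ Q i) := by
    intro j hj i hi
    refine ⟨h.Qx j (by omega) i hi, fun h0 h1 => ⟨fun e => h.PQ i hi j (by omega) e.symm,
      fun e => ?_⟩⟩
    have := h.Qinj j (by omega) i hi e
    omega
  have gx : ∀ j, j = 0 ∨ j = L → ∃ a, ψ a = x j := by
    intro j hj
    refine (h.rng _).2 fun i h0 hi => ⟨fun e => h.Px i hi.le j (by omega) e.symm,
      fun e => h.Qx i hi.le j (by omega) e.symm, fun e => ?_⟩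
    have := h.xinj j (by omega) i hi.le e
    omega
  refine ⟨_, hF.image he f hfib, ?_, ?_, ?_, ?_, ?_, ?_, ?_⟩
  · rintro _ ⟨B, hB, rfl⟩ v hv i hi
    obtain ⟨a, -, rfl⟩ := Finset.mem_image.1 hv
    by_cases a0 : ψ a = x 0
    · rw [f0 a a0]; exact gP 0 (Or.inl rfl) i hi
    by_cases aL : ψ a = x L
    · rw [fL a aL]; exact gP L (Or.inr rfl) i hi
    rw [fo a a0 aL]
    have hr := (h.rng (ψ a)).1 ⟨a, rfl⟩
    refine ⟨?_, fun h0 h1 => ⟨(hr i h0 h1).1, (hr i h0 h1).2.1⟩⟩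
    rcases Nat.eq_zero_or_pos i with rfl | h0
    · exact a0
    rcases hi.eq_or_lt with rfl | h1
    · exact aL
    exact (hr i h0 h1).2.2
  · intro v hv'
    obtain ⟨a, -, ha⟩ := good v hv'
    have := (hv a).image f
    rwa [ha] at this
  · intro u v hu' hv' huv
    obtain ⟨a, ha, ha'⟩ := good u hu'
    obtain ⟨b, hb, hb'⟩ := good v hv'
    have := (he a b ((h.adj' a b).2 (Or.inl (by rw [ha, hb]; exact huv)))).image f
    rwa [ha', hb'] at this
  · obtain ⟨a, ha⟩ := gx 0 (Or.inl rfl)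
    obtain ⟨b, hb, hb'⟩ := good _ (gQ 0 (Or.inl rfl))
    have := (he a b ((h.adj' a b).2 (Or.inl (by
      rw [ha, hb]; exact (h.aQx 0 (by omega)).symm)))).image f
    rwa [f0 a ha, hb'] at this
  · obtain ⟨a, ha⟩ := gx L (Or.inr rfl)
    obtain ⟨b, hb, hb'⟩ := good _ (gQ L (Or.inr rfl))
    have := (he a b ((h.adj' a b).2 (Or.inl (by
      rw [ha, hb]; exact (h.aQx L le_rfl).symm)))).image f
    rwa [fL a ha, hb'] at this
  · obtain ⟨a, ha, ha'⟩ := good _ (gP 0 (Or.inl rfl))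
    obtain ⟨b, hb, hb'⟩ := good _ (gP L (Or.inr rfl))
    have := (he a b ((h.adj' a b).2 (Or.inr (Or.inl ⟨ha, hb⟩)))).image f
    rwa [ha', hb'] at this
  · obtain ⟨a, ha, ha'⟩ := good _ (gQ 0 (Or.inl rfl))
    obtain ⟨b, hb, hb'⟩ := good _ (gQ L (Or.inr rfl))
    have := (he a b ((h.adj' a b).2 (Or.inr (Or.inr (Or.inr (Or.inl ⟨ha, hb⟩)))))).image f
    rwa [ha', hb'] at this

/-- Lower bound on the width and a bag with three of the four corners. -/
lemma ChainRed.corner {V V' : Type*} [DecidableEq V] {D : SimpleGraph V} {D' : SimpleGraph V'}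
    {ψ : V' → V}
    {L : ℕ} {P Q x : ℕ → V} (h : ChainRed D D' ψ L P Q x) {k : ℕ} {F : Set (Finset V)}
    (hF : BagFam k F)
    (he : ∀ u v, (∀ i ≤ L, u ≠ x i ∧ (0 < i → i < L → u ≠ P i ∧ u ≠ Q i)) →
        (∀ i ≤ L, v ≠ x i ∧ (0 < i → i < L → v ≠ P i ∧ v ≠ Q i)) → D.Adj u v → Cv F u v)
    (h00 : Cv F (P 0) (Q 0)) (hLL : Cv F (P L) (Q L)) (hP : Cv F (P 0) (P L))
    (hQ : Cv F (Q 0) (Q L)) :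
    3 ≤ k ∧ ∃ B ∈ F, Q 0 ∈ B ∧ Q L ∈ B ∧ (P 0 ∈ B ∨ P L ∈ B) := by
  have hL := h.hL
  obtain ⟨I, hI, t, bag, htd, rfl⟩ := hF
  have gO : ∀ v ∈ OutS L P Q x, ∀ i ≤ L, v ≠ x i ∧ (0 < i → i < L → v ≠ P i ∧ v ≠ Q i) :=
    fun v hv i hi => ⟨(hv i hi).2.2, fun _ _ => ⟨(hv i hi).1, (hv i hi).2.1⟩⟩
  have gP : ∀ j, j = 0 ∨ j = L → ∀ i ≤ L, P j ≠ x i ∧ (0 < i → i < L → P j ≠ P i ∧ P j ≠ Q i) := by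
    intro j hj i hi
    refine ⟨h.Px j (by omega) i hi, fun h0 h1 => ⟨fun e => ?_, h.PQ j (by omega) i hi⟩⟩
    have := h.Pinj j (by omega) i hi e
    omega
  have gQ : ∀ j, j = 0 ∨ j = L → ∀ i ≤ L, Q j ≠ x i ∧ (0 < i → i < L → Q j ≠ P i ∧ Q j ≠ Q i) := by
    intro j hj i hi
    refine ⟨h.Qx j (by omega) i hi, fun h0 h1 => ⟨fun e => h.PQ i hi j (by omega) e.symm,
      fun e => ?_⟩⟩
    have := h.Qinj j (by omega) i hi e
    omega
  obtain ⟨_, ⟨i1, rfl⟩, h1, h1'⟩ := h00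
  obtain ⟨_, ⟨i2, rfl⟩, h2, h2'⟩ := hLL
  obtain ⟨_, ⟨i3, rfl⟩, h3, h3'⟩ := hP
  obtain ⟨_, ⟨i4, rfl⟩, h4, h4'⟩ := hQ
  have cA : PConn t ({i | P 0 ∈ bag i} ∪ {i | P L ∈ bag i}) :=
    (htd.pc (P 0)).union (htd.pc (P L)) (z := i3) h3 h3'
  have cB := htd.pc (Q 0)
  have cC := htd.pc (Q L)
  have cH : PConn t {i | ∃ v ∈ OutS L P Q x, v ∈ bag i} :=
    pconn_support htd.pc h.conn (fun u hu v hv => he u v (gO u hu) (gO v hv))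
  obtain ⟨v1, hv1, a1⟩ := h.eP0
  obtain ⟨v2, hv2, a2⟩ := h.eQ0
  obtain ⟨v3, hv3, a3⟩ := h.eQL
  obtain ⟨_, ⟨j1, rfl⟩, b1, b1'⟩ := he _ _ (gP 0 (Or.inl rfl)) (gO _ hv1) a1
  obtain ⟨_, ⟨j2, rfl⟩, b2, b2'⟩ := he _ _ (gQ 0 (Or.inl rfl)) (gO _ hv2) a2
  obtain ⟨_, ⟨j3, rfl⟩, b3, b3'⟩ := he _ _ (gQ L (Or.inr rfl)) (gO _ hv3) a3
  obtain ⟨g, ⟨gA, gB⟩, gC, ⟨w, hw, gH⟩⟩ := helly4 htd.tree cA cB cC cH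
    ⟨i1, Or.inl h1, h1'⟩ ⟨i2, Or.inr h2, h2'⟩ ⟨i4, h4, h4'⟩
    ⟨j1, Or.inl b1, ⟨v1, hv1, b1'⟩⟩ ⟨j2, b2, ⟨v2, hv2, b2'⟩⟩ ⟨j3, b3, ⟨v3, hv3, b3'⟩⟩
  refine ⟨?_, bag g, ⟨g, rfl⟩, gB, gC, gA⟩
  have hQQ : Q 0 ≠ Q L := fun e => by
    have := h.Qinj 0 (by omega) L le_rfl e; omega
  have card4 : ∀ j, j = 0 ∨ j = L → P j ∈ bag g → 4 ≤ (bag g).card := by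
    intro j hj hPj
    have hsub : ({P j, Q 0, Q L, w} : Finset V) ⊆ bag g := by
      intro y hy
      simp only [Finset.mem_insert, Finset.mem_singleton] at hy
      rcases hy with rfl | rfl | rfl | rfl
      · exact hPj
      · exact gB
      · exact gC
      · exact gH
    have hc : ({P j, Q 0, Q L, w} : Finset V).card = 4 := by
      have n1 := h.PQ j (by omega) 0 (by omega)
      have n2 := h.PQ j (by omega) L le_rfl
      have n3 := (hw j (by omega)).1.symm
      have n4 := (hw 0 (by omega)).2.1.symm
      have n5 := (hw L le_rfl).2.1.symm
      rw [Finset.card_insert_of_notMem (by simp [n1, n2, n3]),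
        Finset.card_insert_of_notMem (by simp [hQQ, n4]),
        Finset.card_insert_of_notMem (by simp [n5]), Finset.card_singleton]
    rw [← hc]
    exact Finset.card_le_card hsub
  have hk := htd.card g
  rcases gA with hA | hA
  · have := card4 0 (Or.inl rfl) hA
    omega
  · have := card4 L (Or.inr rfl) hA
    omega

/-- Sweeping the grid. -/
lemma ChainRed.sweep {V V' : Type*} [DecidableEq V] {D : SimpleGraph V} {D' : SimpleGraph V'}
    {ψ : V' → V}
    {L : ℕ} {P Q x : ℕ → V} (h : ChainRed D D' ψ L P Q x) {K : ℕ} (hK : 4 ≤ K)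
    {F : Set (Finset V)} (hF : BagFam K F)
    (hfr : ∀ B ∈ F, ∀ v ∈ B, ∀ i ≤ L, v ≠ x i ∧ (0 < i → i < L → v ≠ P i ∧ v ≠ Q i))
    (hB : ∃ B ∈ F, P 0 ∈ B ∧ Q 0 ∈ B ∧ P L ∈ B ∧ Q L ∈ B) (j : ℕ) :
    j < L → ∃ F' : Set (Finset V), F ⊆ F' ∧ BagFam K F' ∧
      (∀ B ∈ F', ∀ v ∈ B, ∀ i ≤ L, v ≠ x i ∧ (j < i → i < L → v ≠ P i ∧ v ≠ Q i)) ∧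
      (∃ B ∈ F', P j ∈ B ∧ Q j ∈ B ∧ P L ∈ B ∧ Q L ∈ B) ∧
      (∀ i < j, Cv F' (P i) (P (i + 1)) ∧ Cv F' (Q i) (Q (i + 1))) ∧
      (∀ i ≤ j, Cv F' (P i) (Q i)) := by
  induction j with
  | zero =>
    intro _
    obtain ⟨B, hB, h1, h2, h3, h4⟩ := hB
    refine ⟨F, subset_rfl, hF, hfr, ⟨B, hB, h1, h2, h3, h4⟩, by simp, ?_⟩
    intro i hi
    obtain rfl : i = 0 := by omega
    exact ⟨B, hB, h1, h2⟩
  | succ j ih =>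
    intro hj
    obtain ⟨F1, hsub, hF1, hfr1, ⟨B, hB1, b1, b2, b3, b4⟩, hcov, hrung⟩ := ih (by omega)
    let B1 : Finset V := {P (j + 1), P j, Q j, P L, Q L}
    let B2 : Finset V := {Q (j + 1), P (j + 1), Q j, P L, Q L}
    have hF2 : BagFam K (insert B1 F1) := by
      apply hF1.add_bag hB1 B1
      · intro v hv
        simp only [B1, Finset.mem_insert, Finset.mem_singleton] at hv
        rcases hv with rfl | rfl | rfl | rfl | rfl
        · exact Or.inr fun C hC hv => ((hfr1 C hC _ hv (j + 1) (by omega)).2 (by omega) hj).1 rfl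
        all_goals left; assumption
      · exact Finset.card_le_five.trans (by omega)
    have hF3 : BagFam K (insert B2 (insert B1 F1)) := by
      apply hF2.add_bag (Set.mem_insert _ _) B2
      · intro v hv
        simp only [B2, Finset.mem_insert, Finset.mem_singleton] at hv
        rcases hv with rfl | hv
        · right
          rintro C (rfl | hC) hv
          · simp only [B1, Finset.mem_insert, Finset.mem_singleton] at hv
            rcases hv with e | e | e | e | e
            · exact h.PQ _ (by omega) _ (by omega) e.symm
            · exact h.PQ _ (by omega) _ (by omega) e.symm
            · have := h.Qinj _ (by omega) _ (by omega) e; omega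
            · exact h.PQ _ (by omega) _ (by omega) e.symm
            · have := h.Qinj _ (by omega) _ (by omega) e; omega
          · exact ((hfr1 C hC _ hv (j + 1) (by omega)).2 (by omega) hj).2 rfl
        · left
          simp only [B1, Finset.mem_insert, Finset.mem_singleton]
          tauto
      · exact Finset.card_le_five.trans (by omega)
    have hsub' : F1 ⊆ insert B2 (insert B1 F1) :=
      (Set.subset_insert _ _).trans (Set.subset_insert _ _)
    have m1 : B1 ∈ insert B2 (insert B1 F1) := Or.inr (Or.inl rfl)
    have m2 : B2 ∈ insert B2 (insert B1 F1) := Or.inl rfl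
    have goodP : ∀ a ≤ L, (a ≤ j + 1 ∨ a = L) → ∀ i ≤ L,
        P a ≠ x i ∧ (j + 1 < i → i < L → P a ≠ P i ∧ P a ≠ Q i) := by
      intro a ha ha' i hi
      refine ⟨h.Px a ha i hi, fun h0 h1 => ⟨fun e => ?_, h.PQ a ha i hi⟩⟩
      have := h.Pinj a ha i hi e
      omega
    have goodQ : ∀ a ≤ L, (a ≤ j + 1 ∨ a = L) → ∀ i ≤ L,
        Q a ≠ x i ∧ (j + 1 < i → i < L → Q a ≠ P i ∧ Q a ≠ Q i) := by
      intro a ha ha' i hi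
      refine ⟨h.Qx a ha i hi, fun h0 h1 => ⟨fun e => h.PQ i hi a ha e.symm, fun e => ?_⟩⟩
      have := h.Qinj a ha i hi e
      omega
    refine ⟨_, hsub.trans hsub', hF3, ?_, ⟨B2, m2, by simp [B2], by simp [B2], by simp [B2],
      by simp [B2]⟩, ?_, ?_⟩
    · rintro C (rfl | rfl | hC) v hv
      · simp only [B2, Finset.mem_insert, Finset.mem_singleton] at hv
        rcases hv with rfl | rfl | rfl | rfl | rfl
        · exact goodQ _ (by omega) (by omega)
        · exact goodP _ (by omega) (by omega)
        · exact goodQ _ (by omega) (by omega)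
        · exact goodP _ (by omega) (by omega)
        · exact goodQ _ (by omega) (by omega)
      · simp only [B1, Finset.mem_insert, Finset.mem_singleton] at hv
        rcases hv with rfl | rfl | rfl | rfl | rfl
        · exact goodP _ (by omega) (by omega)
        · exact goodP _ (by omega) (by omega)
        · exact goodQ _ (by omega) (by omega)
        · exact goodP _ (by omega) (by omega)
        · exact goodQ _ (by omega) (by omega)
      · intro i hi
        have := hfr1 C hC v hv i hi
        exact ⟨this.1, fun h0 h1 => this.2 (by omega) h1⟩
    · intro i hi
      rcases Nat.lt_succ_iff_lt_or_eq.1 hi with hi | rfl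
      · exact ⟨(hcov i hi).1.mono hsub', (hcov i hi).2.mono hsub'⟩
      · exact ⟨⟨B1, m1, by simp [B1], by simp [B1]⟩, ⟨B2, m2, by simp [B2], by simp [B2]⟩⟩
    · intro i hi
      rcases hi.lt_or_eq with hi | rfl
      · exact (hrung i (by omega)).mono hsub'
      · exact ⟨B2, m2, by simp [B2], by simp [B2]⟩

/-- Attaching the taxa. -/
lemma ChainRed.taxa {V V' : Type*} [DecidableEq V] {D : SimpleGraph V} {D' : SimpleGraph V'}
    {ψ : V' → V}
    {L : ℕ} {P Q x : ℕ → V} (h : ChainRed D D' ψ L P Q x) {K : ℕ} (hK : 4 ≤ K)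
    {F : Set (Finset V)} (hF : BagFam K F)
    (hfr : ∀ B ∈ F, ∀ v ∈ B, ∀ i ≤ L, v ≠ x i)
    (hB : ∀ i ≤ L, Cv F (P i) (Q i)) (n : ℕ) :
    n ≤ L + 1 → ∃ F' : Set (Finset V), F ⊆ F' ∧ BagFam K F' ∧
      (∀ B ∈ F', ∀ v ∈ B, ∀ i ≤ L, n ≤ i → v ≠ x i) ∧
      (∀ i < n, Cv F' (P i) (x i) ∧ Cv F' (Q i) (x i)) := by
  induction n with
  | zero => exact fun _ => ⟨F, subset_rfl, hF, fun B hB v hv i hi _ => hfr B hB v hv i hi, by simp⟩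
  | succ n ih =>
    intro hn
    obtain ⟨F1, hsub, hF1, hfr1, hcov⟩ := ih (by omega)
    obtain ⟨C, hC, c1, c2⟩ := hB n (by omega)
    let B1 : Finset V := {x n, P n, Q n}
    refine ⟨insert B1 F1, hsub.trans (Set.subset_insert _ _), ?_, ?_, ?_⟩
    · apply hF1.add_bag (hsub hC) B1
      · intro v hv
        simp only [B1, Finset.mem_insert, Finset.mem_singleton] at hv
        rcases hv with rfl | rfl | rfl
        · exact Or.inr fun C hC hv => hfr1 C hC _ hv n (by omega) le_rfl rfl
        all_goals left; assumption
      · exact Finset.card_le_three.trans (by omega)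
    · rintro B (rfl | hB) v hv i hi hni
      · simp only [B1, Finset.mem_insert, Finset.mem_singleton] at hv
        rcases hv with rfl | rfl | rfl
        · intro e
          have := h.xinj n (by omega) i hi e
          omega
        · exact h.Px _ (by omega) _ hi
        · exact h.Qx _ (by omega) _ hi
      · exact hfr1 B hB v hv i hi (by omega)
    · intro i hi
      rcases Nat.lt_succ_iff_lt_or_eq.1 hi with hi | rfl
      · exact ⟨(hcov i hi).1.mono (Set.subset_insert _ _),
          (hcov i hi).2.mono (Set.subset_insert _ _)⟩
      · exact ⟨⟨B1, Or.inl rfl, by simp [B1], by simp [B1]⟩,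
          ⟨B1, Or.inl rfl, by simp [B1], by simp [B1]⟩⟩

lemma ChainRed.expand {V V' : Type*} {D : SimpleGraph V} {D' : SimpleGraph V'} {ψ : V' → V}
    {L : ℕ} {P Q x : ℕ → V} (h : ChainRed D D' ψ L P Q x) {k : ℕ}
    (hD : HasTreeDecompWidthLE D' k) : HasTreeDecompWidthLE D (k + 1) := by
  classical
  have hL := h.hL
  obtain ⟨F, hF, hfr, hv, he, h00, hLL, hP, hQ⟩ := h.fam1 hD
  obtain ⟨hk, B, hB, bQ0, bQL, bP⟩ := h.corner hF he h00 hLL hP hQ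
  -- add the missing corner to all bags
  obtain ⟨a, ha, haB⟩ : ∃ a, (a = P 0 ∨ a = P L) ∧ P 0 ∈ insert a B ∧ P L ∈ insert a B := by
    rcases bP with hb | hb
    · exact ⟨P L, Or.inr rfl, by simp [hb], by simp⟩
    · exact ⟨P 0, Or.inl rfl, by simp, by simp [hb]⟩
  let F2 : Set (Finset V) := (fun B => insert a B) '' F
  have hF2 : BagFam (k + 1) F2 := hF.insert_all a
  have cv2 : ∀ {u v}, Cv F u v → Cv F2 u v := by
    rintro u v ⟨C, hC, h1, h2⟩
    exact ⟨_, ⟨C, hC, rfl⟩, Finset.mem_insert_of_mem h1, Finset.mem_insert_of_mem h2⟩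
  have gP : ∀ j, j = 0 ∨ j = L → ∀ i ≤ L, P j ≠ x i ∧ (0 < i → i < L → P j ≠ P i ∧ P j ≠ Q i) := by
    intro j hj i hi
    refine ⟨h.Px j (by omega) i hi, fun h0 h1 => ⟨fun e => ?_, h.PQ j (by omega) i hi⟩⟩
    have := h.Pinj j (by omega) i hi e
    omega
  have hfr2 : ∀ B ∈ F2, ∀ v ∈ B, ∀ i ≤ L, v ≠ x i ∧ (0 < i → i < L → v ≠ P i ∧ v ≠ Q i) := by
    rintro _ ⟨C, hC, rfl⟩ v hv
    rcases Finset.mem_insert.1 hv with rfl | hv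
    · rcases ha with rfl | rfl
      · exact gP 0 (Or.inl rfl)
      · exact gP L (Or.inr rfl)
    · exact hfr C hC v hv
  obtain ⟨F3, hs3, hF3, hfr3, ⟨C, hC, c1, c2, c3, c4⟩, hcov3, hr3⟩ :=
    h.sweep (by omega : 4 ≤ k + 1) hF2 hfr2
      ⟨_, ⟨B, hB, rfl⟩, haB.1, Finset.mem_insert_of_mem bQ0, haB.2,
        Finset.mem_insert_of_mem bQL⟩ (L - 1) (by omega)
  have hr3' : ∀ i ≤ L, Cv F3 (P i) (Q i) := by
    intro i hi
    rcases hi.lt_or_eq with hi | rfl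
    · exact hr3 i (by omega)
    · exact ⟨C, hC, c3, c4⟩
  have hPP3 : ∀ i < L, Cv F3 (P i) (P (i + 1)) ∧ Cv F3 (Q i) (Q (i + 1)) := by
    intro i hi
    rcases (show i < L - 1 ∨ i = L - 1 by omega) with hi | rfl
    · exact hcov3 i hi
    · rw [show L - 1 + 1 = L by omega]
      exact ⟨⟨C, hC, c1, c3⟩, ⟨C, hC, c2, c4⟩⟩
  obtain ⟨F4, hs4, hF4, -, hcov4⟩ := h.taxa (by omega : 4 ≤ k + 1) hF3
    (fun B hB v hv i hi => (hfr3 B hB v hv i hi).1) hr3' (L + 1) le_rfl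
  -- neighbours of the special vertices
  have nPc : ∀ i, 0 < i → i < L → ∀ v, D.Adj (P i) v → Cv F4 (P i) v := by
    intro i h0 hi v hadj
    rcases h.nP i h0 hi v hadj with rfl | rfl | rfl
    · have := (hPP3 (i - 1) (by omega)).1
      rw [show i - 1 + 1 = i by omega] at this
      exact (this.mono hs4).symm
    · exact (hPP3 i hi).1.mono hs4
    · exact (hcov4 i (by omega)).1
  have nQc : ∀ i, 0 < i → i < L → ∀ v, D.Adj (Q i) v → Cv F4 (Q i) v := by
    intro i h0 hi v hadj
    rcases h.nQ i h0 hi v hadj with rfl | rfl | rfl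
    · have := (hPP3 (i - 1) (by omega)).2
      rw [show i - 1 + 1 = i by omega] at this
      exact (this.mono hs4).symm
    · exact (hPP3 i hi).2.mono hs4
    · exact (hcov4 i (by omega)).2
  have nxc : ∀ i ≤ L, ∀ v, D.Adj (x i) v → Cv F4 (x i) v := by
    intro i hi v hadj
    rcases h.nx i hi v hadj with rfl | rfl
    · exact (hcov4 i (by omega)).1.symm
    · exact (hcov4 i (by omega)).2.symm
  have dich : ∀ u, (∀ v, D.Adj u v → Cv F4 u v) ∨
      (∀ i ≤ L, u ≠ x i ∧ (0 < i → i < L → u ≠ P i ∧ u ≠ Q i)) := by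
    intro u
    by_contra hcon
    rw [not_or] at hcon
    obtain ⟨n1, n2⟩ := hcon
    apply n2
    intro i hi
    refine ⟨?_, fun h0 h1 => ⟨?_, ?_⟩⟩
    · rintro rfl; exact n1 (nxc i hi)
    · rintro rfl; exact n1 (nPc i h0 h1)
    · rintro rfl; exact n1 (nQc i h0 h1)
  have self : ∀ {u v}, Cv F4 u v → Cv F4 u u := by
    rintro u v ⟨B, hB, h1, h2⟩; exact ⟨B, hB, h1, h1⟩
  refine has_of_fam hF4 ?_ ?_
  · intro v
    by_cases hgood : ∀ i ≤ L, v ≠ x i ∧ (0 < i → i < L → v ≠ P i ∧ v ≠ Q i)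
    · exact ((cv2 (hv v hgood)).mono hs3).mono hs4
    · by_contra hcon
      apply hgood
      intro i hi
      refine ⟨?_, fun h0 h1 => ⟨?_, ?_⟩⟩
      · rintro rfl; exact hcon (self (hcov4 i (by omega)).1.symm)
      · rintro rfl; exact hcon (self (hcov4 i (by omega)).1)
      · rintro rfl; exact hcon (self (hcov4 i (by omega)).2)
  · intro u v huv
    rcases dich u with h1 | h1
    · exact h1 v huv
    rcases dich v with h2 | h2
    · exact (h2 u huv.symm).symm
    exact ((cv2 (he u v h1 h2 huv)).mono hs3).mono hs4

/-- In a reduction the reduced graph has treewidth at least three. -/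
lemma ChainRed.three_le {V V' : Type*} {D : SimpleGraph V} {D' : SimpleGraph V'} {ψ : V' → V}
    {L : ℕ} {P Q x : ℕ → V} (h : ChainRed D D' ψ L P Q x) {k : ℕ}
    (hD : HasTreeDecompWidthLE D' k) : 3 ≤ k := by
  classical
  obtain ⟨F, hF, hfr, hv, he, h00, hLL, hP, hQ⟩ := h.fam1 hD
  exact (h.corner hF he h00 hLL hP hQ).1

lemma ChainRed.final {V V' : Type*} {D : SimpleGraph V} {D' : SimpleGraph V'} {ψ : V' → V}
    {L : ℕ} {P Q x : ℕ → V} (h : ChainRed D D' ψ L P Q x) :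
    treewidth D' - 2 ≤ treewidth D - 2 ∧ treewidth D - 2 ≤ (treewidth D' - 2) + 1 := by
  by_cases hne : ∃ k, HasTreeDecompWidthLE D' k
  · have m' : HasTreeDecompWidthLE D' (treewidth D') := Nat.sInf_mem hne
    have m : HasTreeDecompWidthLE D (treewidth D) :=
      Nat.sInf_mem (s := {k | HasTreeDecompWidthLE D k}) ⟨_, h.expand m'⟩
    have h1 : treewidth D' ≤ treewidth D := Nat.sInf_le (h.minor m)
    have h2 : treewidth D ≤ treewidth D' + 1 := Nat.sInf_le (h.expand m')
    have h3 := h.three_le m'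
    omega
  · have e' : treewidth D' = 0 := by
      unfold treewidth
      rw [Nat.sInf_eq_zero]
      right
      ext k
      simp only [Set.mem_empty_iff_false, iff_false]
      exact fun hk => hne ⟨k, hk⟩
    have e : treewidth D = 0 := by
      unfold treewidth
      rw [Nat.sInf_eq_zero]
      right
      ext k
      simp only [Set.mem_empty_iff_false, iff_false]
      exact fun hk => hne ⟨k, h.minor hk⟩
    omega

/-! ### The display graph -/

section Display

variable {V1 V2 X : Type*} {l1 : X → V1} {l2 : X → V2}

lemma disp_inl_inj {u v : V1} (h : toDisplay l1 l2 (Sum.inl u) = toDisplay l1 l2 (Sum.inl v)) :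
    u = v := by
  have := congrArg Subtype.val h
  simpa [toDisplay, mergeMap] using this

lemma disp_leaf (h2 : Function.Injective l2) (x : X) :
    toDisplay l1 l2 (Sum.inr (l2 x)) = toDisplay l1 l2 (Sum.inl (l1 x)) := by
  apply Subtype.ext
  have hex : ∃ y, l2 y = l2 x := ⟨x, rfl⟩
  simp only [toDisplay, mergeMap, dif_pos hex]
  rw [h2 hex.choose_spec]

lemma disp_inl_inr {u : V1} {w : V2}
    (h : toDisplay l1 l2 (Sum.inl u) = toDisplay l1 l2 (Sum.inr w)) :
    ∃ x, u = l1 x ∧ w = l2 x := by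
  have := congrArg Subtype.val h
  simp only [toDisplay, mergeMap] at this
  split_ifs at this with hex
  exact ⟨hex.choose, Sum.inl.inj this, hex.choose_spec.symm⟩

lemma disp_inr_inj (h1 : Function.Injective l1) (h2 : Function.Injective l2) {u v : V2}
    (h : toDisplay l1 l2 (Sum.inr u) = toDisplay l1 l2 (Sum.inr v)) : u = v := by
  by_cases hu : ∃ x, l2 x = u
  · obtain ⟨x, rfl⟩ := hu
    rw [disp_leaf h2] at h
    obtain ⟨y, hy, rfl⟩ := disp_inl_inr h
    rw [h1 hy]
  · have := congrArg Subtype.val h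
    simp only [toDisplay, mergeMap, dif_neg hu] at this
    split_ifs at this with hex
    exact Sum.inr.inj this

lemma disp_cases (d : DisplayVertex l1 l2) :
    (∃ u, d = toDisplay l1 l2 (Sum.inl u)) ∨ (∃ w, d = toDisplay l1 l2 (Sum.inr w)) := by
  obtain ⟨u | w, h⟩ := d
  · exact Or.inl ⟨u, Subtype.ext h.symm⟩
  · exact Or.inr ⟨w, Subtype.ext h.symm⟩

lemma disp_adj {G1 : SimpleGraph V1} {G2 : SimpleGraph V2} (h1 : Function.Injective l1)
    (h2 : Function.Injective l2) (a b : DisplayVertex l1 l2) :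
    (displayGraph G1 l1 G2 l2).Adj a b ↔
      (∃ u v : V1, G1.Adj u v ∧ a = toDisplay l1 l2 (Sum.inl u) ∧
        b = toDisplay l1 l2 (Sum.inl v)) ∨
      (∃ u v : V2, G2.Adj u v ∧ a = toDisplay l1 l2 (Sum.inr u) ∧
        b = toDisplay l1 l2 (Sum.inr v)) := by
  unfold displayGraph
  rw [SimpleGraph.fromRel_adj]
  constructor
  · rintro ⟨_, h | (⟨u, v, h, ha, hb⟩ | ⟨u, v, h, ha, hb⟩)⟩
    · exact h
    · exact Or.inl ⟨v, u, h.symm, hb, ha⟩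
    · exact Or.inr ⟨v, u, h.symm, hb, ha⟩
  · intro h
    refine ⟨?_, Or.inl h⟩
    rcases h with ⟨u, v, h, ha, hb⟩ | ⟨u, v, h, ha, hb⟩
    · rw [ha, hb]; exact fun e => h.ne (disp_inl_inj e)
    · rw [ha, hb]; exact fun e => h.ne (disp_inr_inj h1 h2 e)

end Display

/-! ### Chain reduction in a single tree -/

structure TreeRed {V X W : Type*} {K : X → Prop} (T : PhyloTree V X)
    (T' : PhyloTree W {x : X // K x}) (L : ℕ) (c : ℕ → X) (p : ℕ → V) (φ : W → V) : Prop where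
  hL : 2 ≤ L
  kept : ∀ y, K y ↔ ∀ i, 0 < i → i < L → c i ≠ y
  inj : Function.Injective φ
  lf : ∀ y, φ (T'.leaf y) = T.leaf y.1
  rng : ∀ v, (∃ w, φ w = v) ↔ ∀ i, 0 < i → i < L → T.leaf (c i) ≠ v ∧ p i ≠ v
  adj : ∀ a b, T'.graph.Adj a b ↔ T.graph.Adj (φ a) (φ b) ∨ (φ a = p 0 ∧ φ b = p L) ∨
    (φ b = p 0 ∧ φ a = p L)
  cinj : ∀ i ≤ L, ∀ j ≤ L, c i = c j → i = j
  pinj : ∀ i ≤ L, ∀ j ≤ L, p i = p j → i = j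
  al : ∀ i ≤ L, T.graph.Adj (p i) (T.leaf (c i))
  ap : ∀ i < L, T.graph.Adj (p i) (p (i + 1))

lemma leaf_nbr {V X : Type*} (T : PhyloTree V X) {y : X} {u v : V}
    (hu : T.graph.Adj (T.leaf y) u) (hv : T.graph.Adj (T.leaf y) v) : u = v := by
  obtain ⟨z, hz⟩ := Set.ncard_eq_one.1 (T.leaf_deg y)
  have h1 : u ∈ T.graph.neighborSet (T.leaf y) := hu
  have h2 : v ∈ T.graph.neighborSet (T.leaf y) := hv
  rw [hz] at h1 h2
  exact h1.trans h2.symm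

section Single

variable {V X W : Type*} {K : X → Prop} {T : PhyloTree V X}
  {T' : PhyloTree W {x : X // K x}} {L : ℕ} {c : ℕ → X} {p : ℕ → V} {φ : W → V}

lemma TreeRed.nonleaf (h : TreeRed T T' L c p φ) : ∀ i ≤ L, ∀ y, T.leaf y ≠ p i := by
  have hL := h.hL
  have mid : ∀ i, 0 < i → i < L → ∀ y, T.leaf y ≠ p i := by
    intro i h0 hi y e
    have h1 := h.ap i hi
    have h2 := (h.ap (i - 1) (by omega)).symm
    rw [show i - 1 + 1 = i by omega] at h2
    rw [← e] at h1 h2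
    have := h.pinj _ (by omega) _ (by omega) (leaf_nbr T h1 h2)
    omega
  intro i hi y e
  rcases Nat.eq_zero_or_pos i with rfl | h0
  · have h1 := h.ap 0 (by omega)
    have h2 := h.al 0 (by omega)
    rw [← e] at h1 h2
    exact mid 1 (by omega) (by omega) _ (leaf_nbr T h2 h1)
  rcases hi.lt_or_eq with hi | rfl
  · exact mid i h0 hi y e
  · have h1 := (h.ap (i - 1) (by omega)).symm
    rw [show i - 1 + 1 = i by omega] at h1
    have h2 := h.al i le_rfl
    rw [← e] at h1 h2
    exact mid (i - 1) (by omega) (by omega) _ (leaf_nbr T h2 h1)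

lemma TreeRed.midnbr (h : TreeRed T T' L c p φ) (i : ℕ) (h0 : 0 < i) (hi : i < L) (v : V)
    (hv : T.graph.Adj (p i) v) : v = p (i - 1) ∨ v = p (i + 1) ∨ v = T.leaf (c i) := by
  have hfin : Finite V := T.finite
  have h3 := T.internal_deg (p i) (h.nonleaf i hi.le)
  have h2 := (h.ap (i - 1) (by omega)).symm
  rw [show i - 1 + 1 = i by omega] at h2
  have hsub : ({p (i - 1), p (i + 1), T.leaf (c i)} : Set V) ⊆ T.graph.neighborSet (p i) := by
    rintro z (rfl | rfl | rfl)
    · exact h2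
    · exact h.ap i hi
    · exact h.al i hi.le
  have hne : p (i - 1) ≠ p (i + 1) := fun e => by
    have := h.pinj _ (by omega) _ (by omega) e; omega
  have hcard : ({p (i - 1), p (i + 1), T.leaf (c i)} : Set V).ncard = 3 :=
    Set.ncard_eq_three.2 ⟨_, _, _, hne, (h.nonleaf _ (by omega) _).symm,
      (h.nonleaf _ (by omega) _).symm, rfl⟩
  have heq := Set.eq_of_subset_of_ncard_le hsub (by rw [h3, hcard]) (Set.toFinite _)
  have : v ∈ ({p (i - 1), p (i + 1), T.leaf (c i)} : Set V) := by rw [heq]; exact hv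
  simpa using this

lemma TreeRed.ext (h : TreeRed T T' L c p φ) (e e' : ℕ) (he : (e = 0 ∧ e' = L) ∨ (e = L ∧ e' = 0)) :
    ∃ v, T.graph.Adj (p e) v ∧ ∀ i ≤ L, v ≠ p i ∧ v ≠ T.leaf (c i) := by
  have hL := h.hL
  have hpr : ∀ j, j = 0 ∨ j = L → ∃ w, φ w = p j := by
    intro j hj
    refine (h.rng _).2 fun i h0 hi => ⟨h.nonleaf _ (by omega) _, fun e => ?_⟩
    have := h.pinj _ (by omega) _ (by omega) e
    omega
  obtain ⟨w, hw⟩ := hpr e (by omega)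
  obtain ⟨w', hw'⟩ := hpr e' (by omega)
  have hK : K (c e) := (h.kept _).2 fun i h0 hi heq => by
    have := h.cinj _ (by omega) _ (by omega) heq
    omega
  have hnl : ∀ y, T'.leaf y ≠ w := by
    rintro y rfl
    rw [h.lf] at hw
    exact h.nonleaf e (by omega) _ hw
  have h3 := T'.internal_deg w hnl
  have hlt : ({w', T'.leaf ⟨c e, hK⟩} : Set W).ncard < (T'.graph.neighborSet w).ncard := by
    rw [h3]
    exact (Set.ncard_insert_le _ _).trans_lt (by rw [Set.ncard_singleton]; omega)
  obtain ⟨z, hz, hzn⟩ := Set.exists_mem_notMem_of_ncard_lt_ncard hlt (Set.toFinite _)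
  have hz1 : z ≠ w' := fun e => hzn (by simp [e])
  have hz2 : z ≠ T'.leaf ⟨c e, hK⟩ := fun e => hzn (by simp [e])
  have hadj : T'.graph.Adj w z := hz
  have hpz : φ z ≠ p e' := fun e => hz1 (h.inj (e.trans hw'.symm))
  have hT : T.graph.Adj (p e) (φ z) := by
    rcases (h.adj w z).1 hadj with h1 | ⟨h1, h2⟩ | ⟨h1, h2⟩
    · rwa [hw] at h1
    · exfalso
      rw [hw] at h1
      have := h.pinj _ (by omega) _ (by omega) h1
      apply hpz
      rw [h2]; congr 1; omega
    · exfalso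
      rw [hw] at h2
      have := h.pinj _ (by omega) _ (by omega) h2
      apply hpz
      rw [h1]; congr 1; omega
  have hr := (h.rng (φ z)).1 ⟨z, rfl⟩
  refine ⟨φ z, hT, fun i hi => ?_⟩
  by_cases hm : 0 < i ∧ i < L
  · exact ⟨(hr i hm.1 hm.2).2.symm, (hr i hm.1 hm.2).1.symm⟩
  rcases (show i = e ∨ i = e' by omega) with rfl | rfl
  · refine ⟨hT.ne', fun heq => hz2 (h.inj ?_)⟩
    rw [heq, h.lf]
  · refine ⟨hpz, fun heq => ?_⟩
    rw [heq] at hT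
    have := h.pinj _ (by omega) _ (by omega) (leaf_nbr T hT.symm (h.al i hi).symm)
    omega

end Single

lemma treeRed_of_clipped {V X W : Type*} {L : ℕ} (hL : 2 ≤ L) {T : PhyloTree V X}
    {c : Fin (L + 1) → X} {p : Fin (L + 1) → V} (hc : PhyloChain T (L + 1) c p)
    {T' : PhyloTree W {x : X // ∀ i : Fin (L + 1), ¬ keepIdx (L + 1) 2 i → c i ≠ x}}
    (h : IsClippedChain T (L + 1) c p 2 T') :
    ∃ φ : W → V, TreeRed (K := fun x => ∀ i : Fin (L + 1), ¬ keepIdx (L + 1) 2 i → c i ≠ x)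
      T T' L (fun i => c (Fin.ofNat (L + 1) i)) (fun i => p (Fin.ofNat (L + 1) i)) φ := by
  obtain ⟨φ, h1, h2, h3, h4⟩ := h
  obtain ⟨c1, c2, c3, c4⟩ := hc
  have fin_eq : ∀ i (hi : i < L + 1), Fin.ofNat (L + 1) i = ⟨i, hi⟩ := by
    intro i hi
    apply Fin.ext
    simp [Fin.ofNat, Nat.mod_eq_of_lt hi]
  have keep : ∀ i : Fin (L + 1), ¬ keepIdx (L + 1) 2 i ↔ 0 < i.1 ∧ i.1 < L := by
    intro i
    unfold keepIdx
    omega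
  have quant : ∀ R : Fin (L + 1) → Prop, (∀ i : Fin (L + 1), ¬ keepIdx (L + 1) 2 i → R i) ↔
      ∀ i, 0 < i → i < L → R (Fin.ofNat (L + 1) i) := by
    intro R
    constructor
    · intro hR i h0 hi
      rw [fin_eq i (by omega)]
      exact hR _ ((keep _).2 ⟨h0, hi⟩)
    · intro hR i hi
      have := hR i.1 ((keep i).1 hi).1 ((keep i).1 hi).2
      rwa [fin_eq i.1 i.2] at this
  refine ⟨φ, ⟨hL, fun y => quant _, h1, h2, ?_, ?_, ?_, ?_, ?_, ?_⟩⟩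
  · intro v
    have : (∃ w, φ w = v) ↔ v ∈ Set.range φ := Iff.rfl
    rw [this, h3]
    exact quant (fun i => T.leaf (c i) ≠ v ∧ p i ≠ v)
  · intro a b
    rw [h4]
    have e0 : Fin.ofNat (L + 1) 0 = ⟨0, by omega⟩ := fin_eq 0 (by omega)
    have eL : Fin.ofNat (L + 1) L = ⟨L, by omega⟩ := fin_eq L (by omega)
    simp only [e0, eL]
    constructor
    · rintro (h | ⟨_, _, h⟩)
      · exact Or.inl h
      · exact Or.inr h
    · rintro (h | h)
      · exact Or.inl h
      · exact Or.inr ⟨by omega, by omega, h⟩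
  · intro i hi j hj e
    have := c1 e
    rw [fin_eq i (by omega), fin_eq j (by omega)] at this
    simpa using this
  · intro i hi j hj e
    have := c2 e
    rw [fin_eq i (by omega), fin_eq j (by omega)] at this
    simpa using this
  · intro i hi
    exact c3 _
  · intro i hi
    have := c4 i (by omega)
    rw [← fin_eq i (by omega), ← fin_eq (i + 1) (by omega)] at this
    exact this

/-! ### Combining the two trees -/

/-- The map of display vertices induced by maps of the two trees. -/
noncomputable def dispMap {V1 V2 X W1 W2 Y : Type*} {m1 : Y → W1} {m2 : Y → W2} (l1 : X → V1)
    (l2 : X → V2) (φ1 : W1 → V1) (φ2 : W2 → V2) (d : DisplayVertex m1 m2) :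
    DisplayVertex l1 l2 :=
  toDisplay l1 l2 (Sum.map φ1 φ2 d.1)

lemma chainRed_of_treeRed {V1 V2 X W1 W2 : Type*} {K : X → Prop} {T1 : PhyloTree V1 X}
    {T2 : PhyloTree V2 X} {T1' : PhyloTree W1 {x : X // K x}} {T2' : PhyloTree W2 {x : X // K x}}
    {L : ℕ} {c : ℕ → X} {p : ℕ → V1} {q : ℕ → V2} {φ1 : W1 → V1} {φ2 : W2 → V2}
    (h1 : TreeRed T1 T1' L c p φ1) (h2 : TreeRed T2 T2' L c q φ2)
    (hconn : PConn (displayGraph T1.graph T1.leaf T2.graph T2.leaf)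
      (OutS L (fun i => toDisplay T1.leaf T2.leaf (Sum.inl (p i)))
        (fun i => toDisplay T1.leaf T2.leaf (Sum.inr (q i)))
        (fun i => toDisplay T1.leaf T2.leaf (Sum.inl (T1.leaf (c i)))))) :
    ChainRed (displayGraph T1.graph T1.leaf T2.graph T2.leaf)
      (displayGraph T1'.graph T1'.leaf T2'.graph T2'.leaf)
      (dispMap T1.leaf T2.leaf φ1 φ2) L
      (fun i => toDisplay T1.leaf T2.leaf (Sum.inl (p i)))
      (fun i => toDisplay T1.leaf T2.leaf (Sum.inr (q i)))
      (fun i => toDisplay T1.leaf T2.leaf (Sum.inl (T1.leaf (c i)))) := by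
  have i1 := T1.leaf_inj
  have i2 := T2.leaf_inj
  have i1' := T1'.leaf_inj
  have i2' := T2'.leaf_inj
  have lfe : ∀ y, toDisplay T1.leaf T2.leaf (Sum.inr (T2.leaf y)) =
    toDisplay T1.leaf T2.leaf (Sum.inl (T1.leaf y)) := disp_leaf i2
  have lfe' : ∀ y, toDisplay T1'.leaf T2'.leaf (Sum.inr (T2'.leaf y)) =
    toDisplay T1'.leaf T2'.leaf (Sum.inl (T1'.leaf y)) := disp_leaf i2'
  have ψ1 : ∀ w, dispMap T1.leaf T2.leaf φ1 φ2 (toDisplay T1'.leaf T2'.leaf (Sum.inl w)) =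
      toDisplay T1.leaf T2.leaf (Sum.inl (φ1 w)) := fun w => rfl
  have ψ2 : ∀ w, dispMap T1.leaf T2.leaf φ1 φ2 (toDisplay T1'.leaf T2'.leaf (Sum.inr w)) =
      toDisplay T1.leaf T2.leaf (Sum.inr (φ2 w)) := by
    intro w
    by_cases hw : ∃ y, T2'.leaf y = w
    · obtain ⟨y, rfl⟩ := hw
      rw [lfe', ψ1, h1.lf, h2.lf, lfe]
    · unfold dispMap
      congr 1
      simp only [toDisplay, mergeMap, dif_neg hw, Sum.map_inr]
  -- kept leaves
  have k1 : ∀ w y, φ1 w = T1.leaf y → ∃ hy : K y, w = T1'.leaf ⟨y, hy⟩ := by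
    intro w y hw
    have hy : K y := (h1.kept y).2 fun i h0 hi e => by
      have := ((h1.rng (φ1 w)).1 ⟨w, rfl⟩ i h0 hi).1
      exact this (by rw [e, hw])
    exact ⟨hy, h1.inj (by rw [hw, h1.lf])⟩
  have k2 : ∀ w y, φ2 w = T2.leaf y → ∃ hy : K y, w = T2'.leaf ⟨y, hy⟩ := by
    intro w y hw
    have hy : K y := (h2.kept y).2 fun i h0 hi e => by
      have := ((h2.rng (φ2 w)).1 ⟨w, rfl⟩ i h0 hi).1
      exact this (by rw [e, hw])
    exact ⟨hy, h2.inj (by rw [hw, h2.lf])⟩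
  have inv1 : ∀ a u, dispMap T1.leaf T2.leaf φ1 φ2 a = toDisplay T1.leaf T2.leaf (Sum.inl u) →
      ∃ w, a = toDisplay T1'.leaf T2'.leaf (Sum.inl w) ∧ φ1 w = u := by
    intro a u ha
    rcases disp_cases a with ⟨w, rfl⟩ | ⟨w, rfl⟩
    · exact ⟨w, rfl, disp_inl_inj ha⟩
    · rw [ψ2] at ha
      obtain ⟨y, rfl, hy⟩ := disp_inl_inr ha.symm
      obtain ⟨hK, rfl⟩ := k2 w y hy
      exact ⟨T1'.leaf ⟨y, hK⟩, lfe' _, h1.lf _⟩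
  have inv2 : ∀ a u, dispMap T1.leaf T2.leaf φ1 φ2 a = toDisplay T1.leaf T2.leaf (Sum.inr u) →
      ∃ w, a = toDisplay T1'.leaf T2'.leaf (Sum.inr w) ∧ φ2 w = u := by
    intro a u ha
    rcases disp_cases a with ⟨w, rfl⟩ | ⟨w, rfl⟩
    · rw [ψ1] at ha
      obtain ⟨y, hy, rfl⟩ := disp_inl_inr ha
      obtain ⟨hK, rfl⟩ := k1 w y hy
      exact ⟨T2'.leaf ⟨y, hK⟩, (lfe' _).symm, h2.lf _⟩
    · rw [ψ2] at ha
      exact ⟨w, rfl, disp_inr_inj i1 i2 ha⟩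
  have PQ : ∀ i ≤ L, ∀ v, toDisplay T1.leaf T2.leaf (Sum.inl (p i)) ≠
      toDisplay T1.leaf T2.leaf (Sum.inr v) := by
    intro i hi v e
    obtain ⟨y, hy, -⟩ := disp_inl_inr e
    exact h1.nonleaf i hi y hy.symm
  have QP : ∀ i ≤ L, ∀ v, toDisplay T1.leaf T2.leaf (Sum.inl v) ≠
      toDisplay T1.leaf T2.leaf (Sum.inr (q i)) := by
    intro i hi v e
    obtain ⟨y, -, hy⟩ := disp_inl_inr e
    exact h2.nonleaf i hi y hy.symm
  have adj1 : ∀ u v, T1.graph.Adj u v →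
      (displayGraph T1.graph T1.leaf T2.graph T2.leaf).Adj
        (toDisplay T1.leaf T2.leaf (Sum.inl u)) (toDisplay T1.leaf T2.leaf (Sum.inl v)) :=
    fun u v h => (disp_adj i1 i2 _ _).2 (Or.inl ⟨u, v, h, rfl, rfl⟩)
  have adj2 : ∀ u v, T2.graph.Adj u v →
      (displayGraph T1.graph T1.leaf T2.graph T2.leaf).Adj
        (toDisplay T1.leaf T2.leaf (Sum.inr u)) (toDisplay T1.leaf T2.leaf (Sum.inr v)) :=
    fun u v h => (disp_adj i1 i2 _ _).2 (Or.inr ⟨u, v, h, rfl, rfl⟩)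
  have ext1 : ∀ e e', (e = 0 ∧ e' = L) ∨ (e = L ∧ e' = 0) →
      ∃ v ∈ OutS L (fun i => toDisplay T1.leaf T2.leaf (Sum.inl (p i)))
        (fun i => toDisplay T1.leaf T2.leaf (Sum.inr (q i)))
        (fun i => toDisplay T1.leaf T2.leaf (Sum.inl (T1.leaf (c i)))),
        (displayGraph T1.graph T1.leaf T2.graph T2.leaf).Adj
          (toDisplay T1.leaf T2.leaf (Sum.inl (p e))) v := by
    intro e e' he
    obtain ⟨v, hv, hv'⟩ := h1.ext e e' he
    refine ⟨_, fun i hi => ⟨fun e => (hv' i hi).1 (disp_inl_inj e), QP i hi v,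
      fun e => (hv' i hi).2 (disp_inl_inj e)⟩, adj1 _ _ hv⟩
  have ext2 : ∀ e e', (e = 0 ∧ e' = L) ∨ (e = L ∧ e' = 0) →
      ∃ v ∈ OutS L (fun i => toDisplay T1.leaf T2.leaf (Sum.inl (p i)))
        (fun i => toDisplay T1.leaf T2.leaf (Sum.inr (q i)))
        (fun i => toDisplay T1.leaf T2.leaf (Sum.inl (T1.leaf (c i)))),
        (displayGraph T1.graph T1.leaf T2.graph T2.leaf).Adj
          (toDisplay T1.leaf T2.leaf (Sum.inr (q e))) v := by
    intro e e' he
    obtain ⟨v, hv, hv'⟩ := h2.ext e e' he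
    refine ⟨_, fun i hi => ⟨fun e => PQ i hi v e.symm, fun e => (hv' i hi).1 (disp_inr_inj i1 i2 e),
      fun e => (hv' i hi).2 (disp_inr_inj i1 i2 (e.trans (lfe _).symm))⟩, adj2 _ _ hv⟩
  refine
    { hL := h1.hL, inj := ?_, rng := ?_, adj' := ?_, Pinj := ?_, Qinj := ?_, xinj := ?_, PQ := ?_,
      Px := ?_, Qx := ?_, aPx := ?_, aQx := ?_, aPP := ?_, aQQ := ?_, nx := ?_, nP := ?_,
      nQ := ?_, conn := hconn, eP0 := ext1 0 L (Or.inl ⟨rfl, rfl⟩),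
      ePL := ext1 L 0 (Or.inr ⟨rfl, rfl⟩), eQ0 := ext2 0 L (Or.inl ⟨rfl, rfl⟩),
      eQL := ext2 L 0 (Or.inr ⟨rfl, rfl⟩) }
  · intro a b hab
    rcases disp_cases b with ⟨w, rfl⟩ | ⟨w, rfl⟩
    · rw [ψ1] at hab
      obtain ⟨w', rfl, hw⟩ := inv1 a _ hab
      rw [h1.inj hw]
    · rw [ψ2] at hab
      obtain ⟨w', rfl, hw⟩ := inv2 a _ hab
      rw [h2.inj hw]
  · intro v
    constructor
    · rintro ⟨a, rfl⟩ i h0 hi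
      rcases disp_cases a with ⟨w, rfl⟩ | ⟨w, rfl⟩
      · rw [ψ1]
        have hr := (h1.rng (φ1 w)).1 ⟨w, rfl⟩ i h0 hi
        exact ⟨fun e => hr.2 (disp_inl_inj e).symm, QP i hi.le _,
          fun e => hr.1 (disp_inl_inj e).symm⟩
      · rw [ψ2]
        have hr := (h2.rng (φ2 w)).1 ⟨w, rfl⟩ i h0 hi
        exact ⟨fun e => PQ i hi.le _ e.symm, fun e => hr.2 (disp_inr_inj i1 i2 e).symm,
          fun e => hr.1 (disp_inr_inj i1 i2 (e.trans (lfe _).symm)).symm⟩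
    · intro hv
      rcases disp_cases v with ⟨u, rfl⟩ | ⟨u, rfl⟩
      · obtain ⟨w, rfl⟩ := (h1.rng u).2 fun i h0 hi =>
          ⟨fun e => (hv i h0 hi).2.2 (by rw [e]), fun e => (hv i h0 hi).1 (by rw [e])⟩
        exact ⟨_, ψ1 w⟩
      · obtain ⟨w, rfl⟩ := (h2.rng u).2 fun i h0 hi =>
          ⟨fun e => (hv i h0 hi).2.2 (by rw [← e, lfe]), fun e => (hv i h0 hi).2.1 (by rw [e])⟩
        exact ⟨_, ψ2 w⟩
  · intro a b
    rw [disp_adj i1' i2', disp_adj i1 i2]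
    constructor
    · rintro (⟨u, v, huv, rfl, rfl⟩ | ⟨u, v, huv, rfl, rfl⟩)
      · simp only [ψ1]
        rcases (h1.adj u v).1 huv with h | ⟨ha, hb⟩ | ⟨ha, hb⟩
        · exact Or.inl (Or.inl ⟨_, _, h, rfl, rfl⟩)
        · right; left; rw [ha, hb]; exact ⟨rfl, rfl⟩
        · right; right; left; rw [ha, hb]; exact ⟨rfl, rfl⟩
      · simp only [ψ2]
        rcases (h2.adj u v).1 huv with h | ⟨ha, hb⟩ | ⟨ha, hb⟩
        · exact Or.inl (Or.inr ⟨_, _, h, rfl, rfl⟩)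
        · right; right; right; left; rw [ha, hb]; exact ⟨rfl, rfl⟩
        · right; right; right; right; rw [ha, hb]; exact ⟨rfl, rfl⟩
    · rintro ((⟨u, v, huv, ha, hb⟩ | ⟨u, v, huv, ha, hb⟩) | ⟨ha, hb⟩ | ⟨hb, ha⟩ | ⟨ha, hb⟩ |
        ⟨hb, ha⟩)
      · obtain ⟨w, rfl, rfl⟩ := inv1 a _ ha
        obtain ⟨w', rfl, rfl⟩ := inv1 b _ hb
        exact Or.inl ⟨w, w', (h1.adj _ _).2 (Or.inl huv), rfl, rfl⟩
      · obtain ⟨w, rfl, rfl⟩ := inv2 a _ ha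
        obtain ⟨w', rfl, rfl⟩ := inv2 b _ hb
        exact Or.inr ⟨w, w', (h2.adj _ _).2 (Or.inl huv), rfl, rfl⟩
      · obtain ⟨w, rfl, hw⟩ := inv1 a _ ha
        obtain ⟨w', rfl, hw'⟩ := inv1 b _ hb
        exact Or.inl ⟨w, w', (h1.adj _ _).2 (Or.inr (Or.inl ⟨hw, hw'⟩)), rfl, rfl⟩
      · obtain ⟨w, rfl, hw⟩ := inv1 a _ ha
        obtain ⟨w', rfl, hw'⟩ := inv1 b _ hb
        exact Or.inl ⟨w, w', (h1.adj _ _).2 (Or.inr (Or.inr ⟨hw', hw⟩)), rfl, rfl⟩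
      · obtain ⟨w, rfl, hw⟩ := inv2 a _ ha
        obtain ⟨w', rfl, hw'⟩ := inv2 b _ hb
        exact Or.inr ⟨w, w', (h2.adj _ _).2 (Or.inr (Or.inl ⟨hw, hw'⟩)), rfl, rfl⟩
      · obtain ⟨w, rfl, hw⟩ := inv2 a _ ha
        obtain ⟨w', rfl, hw'⟩ := inv2 b _ hb
        exact Or.inr ⟨w, w', (h2.adj _ _).2 (Or.inr (Or.inr ⟨hw', hw⟩)), rfl, rfl⟩
  · exact fun i hi j hj e => h1.pinj i hi j hj (disp_inl_inj e)
  · exact fun i hi j hj e => h2.pinj i hi j hj (disp_inr_inj i1 i2 e)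
  · exact fun i hi j hj e => h1.cinj i hi j hj (i1 (disp_inl_inj e))
  · exact fun i hi j hj => PQ i hi _
  · exact fun i hi j hj e => h1.nonleaf i hi _ (disp_inl_inj e).symm
  · exact fun i hi j hj e => QP i hi _ e.symm
  · exact fun i hi => adj1 _ _ (h1.al i hi)
  · intro i hi
    have := adj2 _ _ (h2.al i hi)
    rwa [lfe] at this
  · exact fun i hi => adj1 _ _ (h1.ap i hi)
  · exact fun i hi => adj2 _ _ (h2.ap i hi)
  · intro i hi v hv
    rcases (disp_adj i1 i2 _ _).1 hv with ⟨u, w, huw, ha, rfl⟩ | ⟨u, w, huw, ha, rfl⟩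
    · have := disp_inl_inj ha
      subst this
      left
      rw [leaf_nbr T1 huw (h1.al i hi).symm]
    · have := disp_inr_inj i1 i2 ((lfe _).trans ha)
      subst this
      right
      rw [leaf_nbr T2 huw (h2.al i hi).symm]
  · intro i h0 hi v hv
    rcases (disp_adj i1 i2 _ _).1 hv with ⟨u, w, huw, ha, rfl⟩ | ⟨u, w, huw, ha, rfl⟩
    · have := disp_inl_inj ha
      subst this
      rcases h1.midnbr i h0 hi w huw with rfl | rfl | rfl
      · exact Or.inl rfl
      · exact Or.inr (Or.inl rfl)
      · exact Or.inr (Or.inr rfl)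
    · exact absurd ha (PQ i hi.le u)
  · intro i h0 hi v hv
    rcases (disp_adj i1 i2 _ _).1 hv with ⟨u, w, huw, ha, rfl⟩ | ⟨u, w, huw, ha, rfl⟩
    · exact absurd ha.symm (QP i hi.le u)
    · have := disp_inr_inj i1 i2 ha
      subst this
      rcases h2.midnbr i h0 hi w huw with rfl | rfl | rfl
      · exact Or.inl rfl
      · exact Or.inr (Or.inl rfl)
      · exact Or.inr (Or.inr (lfe _))

lemma conn_of_not_sep {V1 V2 X : Type*} {T1 : PhyloTree V1 X} {T2 : PhyloTree V2 X} {L : ℕ}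
    {c : Fin (L + 1) → X} {p : Fin (L + 1) → V1} {q : Fin (L + 1) → V2}
    (hsep : ¬ GridSeparates T1 T2 (L + 1) c p q) :
    PConn (displayGraph T1.graph T1.leaf T2.graph T2.leaf)
      (OutS L (fun i => toDisplay T1.leaf T2.leaf (Sum.inl (p (Fin.ofNat (L + 1) i))))
        (fun i => toDisplay T1.leaf T2.leaf (Sum.inr (q (Fin.ofNat (L + 1) i))))
        (fun i => toDisplay T1.leaf T2.leaf (Sum.inl (T1.leaf (c (Fin.ofNat (L + 1) i)))))) := by
  unfold GridSeparates at hsep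
  rw [not_not] at hsep
  have fin_eq : ∀ i : Fin (L + 1), Fin.ofNat (L + 1) i.1 = i := by
    intro i
    apply Fin.ext
    simp [Fin.ofNat, Nat.mod_eq_of_lt i.2]
  have hlt : ∀ i : Fin (L + 1), i.1 ≤ L := fun i => Nat.lt_succ_iff.1 i.2
  let f : (chainSuppressedDisplay T1 T2 (L + 1) c p q).induce
      {w : {u : DisplayVertex T1.leaf T2.leaf // u ∉ chainTaxaV T1 T2 (L + 1) c} |
        w.1 ∉ gridV T1 T2 (L + 1) p q} →g displayGraph T1.graph T1.leaf T2.graph T2.leaf :=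
    { toFun := fun w => w.1.1
      map_rel' := by
        rintro a b hab
        have hab' : (chainSuppressedDisplay T1 T2 (L + 1) c p q).Adj a.1 b.1 := hab
        unfold chainSuppressedDisplay at hab'
        rw [SimpleGraph.fromRel_adj] at hab'
        rcases hab'.2 with (h | ⟨i, h, -⟩) | (h | ⟨i, h, -⟩)
        · exact h
        · exact absurd ⟨i, Or.inl h⟩ a.2
        · exact h.symm
        · exact absurd ⟨i, Or.inl h⟩ b.2 }
  have out : ∀ u ∈ OutS L (fun i => toDisplay T1.leaf T2.leaf (Sum.inl (p (Fin.ofNat (L + 1) i))))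
        (fun i => toDisplay T1.leaf T2.leaf (Sum.inr (q (Fin.ofNat (L + 1) i))))
        (fun i => toDisplay T1.leaf T2.leaf (Sum.inl (T1.leaf (c (Fin.ofNat (L + 1) i))))),
      u ∉ chainTaxaV T1 T2 (L + 1) c ∧ u ∉ gridV T1 T2 (L + 1) p q := by
    intro u hu
    constructor
    · rintro ⟨i, hi⟩
      have := (hu i.1 (hlt i)).2.2
      simp only [fin_eq] at this
      exact this hi
    · rintro ⟨i, hi | hi⟩
      · have := (hu i.1 (hlt i)).1
        simp only [fin_eq] at this
        exact this hi
      · have := (hu i.1 (hlt i)).2.1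
        simp only [fin_eq] at this
        exact this hi
  intro u hu v hv
  obtain ⟨w⟩ := hsep ⟨⟨u, (out u hu).1⟩, (out u hu).2⟩ ⟨⟨v, (out v hv).1⟩, (out v hv).2⟩
  refine JnIn.map (S := Set.univ) f ?_ ⟨w, fun _ _ => trivial⟩
  intro z _ i hi
  exact ⟨fun e => z.2 ⟨_, Or.inl e⟩, fun e => z.2 ⟨_, Or.inr e⟩, fun e => z.1.2 ⟨_, e⟩⟩

/-- If `T1', T2'` are incompatible trees obtained by clipping a common chain `C`
of `T1, T2` down to length 2 (the 2-cc reduction) and the grid `g(C)` is *not* a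
separator of the display graph `D(T1,T2)`, then
`d_tw(T1',T2') ≤ d_tw(T1,T2) ≤ d_tw(T1',T2') + 1`. -/
theorem dtw_two_cc_nonseparator {V1 V2 X W1 W2 : Type*}
    (T1 : PhyloTree V1 X) (T2 : PhyloTree V2 X)
    (t : ℕ) (ht : 3 ≤ t) (c : Fin t → X) (p : Fin t → V1) (q : Fin t → V2)
    (hc1 : PhyloChain T1 t c p) (hc2 : PhyloChain T2 t c q)
    (T1' : PhyloTree W1 {x : X // ∀ i : Fin t, ¬ keepIdx t 2 i → c i ≠ x})
    (T2' : PhyloTree W2 {x : X // ∀ i : Fin t, ¬ keepIdx t 2 i → c i ≠ x})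
    (h1 : IsClippedChain T1 t c p 2 T1') (h2 : IsClippedChain T2 t c q 2 T2')
    (hinc : ¬ Compatible T1' T2')
    (hsep : ¬ GridSeparates T1 T2 t c p q) :
    dtw T1' T2' ≤ dtw T1 T2 ∧ dtw T1 T2 ≤ dtw T1' T2' + 1 := by
  obtain ⟨L, rfl⟩ : ∃ L, t = L + 1 := ⟨t - 1, by omega⟩
  have hL : 2 ≤ L := by omega
  obtain ⟨φ1, hφ1⟩ := treeRed_of_clipped hL hc1 h1
  obtain ⟨φ2, hφ2⟩ := treeRed_of_clipped hL hc2 h2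
  exact (chainRed_of_treeRed hφ1 hφ2 (conn_of_not_sep hsep)).final
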